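/- arXiv:math/9909068 — 2 statements merged into one kernel-verified Lean document; each statement's English description precedes it below -/
import Mathlib

section
/- Lemma 4.3 (type I highest elements): Let n ≥ 2, l ≥ k ≥ 1, let ι : B_l ⊗ B_k → B_k ⊗ B_l be any isomorphism of U_q'(C_n^(1)) crystals and H any energy function for ι. Let x_1, x_2, x̄_1 be nonnegative integers with k − x_1 − x_2 − x̄_1 a nonnegative even integer, and set x_0 = (k − x_1 − x_2 − x̄_1)/2 and y = min(l − k, (x̄_1 − x_1)_+), where (t)_+ := max(t, 0). Then ι((l,0,…,0) ⊗ (x_1,x_2,---,x̄_1)) = (k,0,…,0) ⊗ (x_1+l−k−y, x_2, ---, x̄_1−y), and H((l,0,…,0) ⊗ (x_1,x_2,---,x̄_1)) = x_0 + (x_1 − x̄_1)_+. -/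
namespace KTT

/-- Raw data of a crystal element `(x_1,…,x_n,x̄_n,…,x̄_1)`:
`b.1 i` is `x_{i+1}` and `b.2 i` is `x̄_{i+1}` for `i : Fin n`. -/
abbrev Tup (n : ℕ) := (Fin n → ℕ) × (Fin n → ℕ)

/-- The entry `x_j` (for `1 ≤ j ≤ n`). -/
def xc {n : ℕ} (b : Tup n) (j : ℕ) : ℕ :=
  if h : j - 1 < n then b.1 ⟨j - 1, h⟩ else 0

/-- The entry `x̄_j` (for `1 ≤ j ≤ n`). -/
def xbc {n : ℕ} (b : Tup n) (j : ℕ) : ℕ :=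
  if h : j - 1 < n then b.2 ⟨j - 1, h⟩ else 0

/-- Set the entry indexed by `j` (i.e. `x_j`) to the value `v`. -/
def setx {n : ℕ} (f : Fin n → ℕ) (j v : ℕ) : Fin n → ℕ :=
  fun t => if (t : ℕ) + 1 = j then v else f t

/-- `Σ_{i=1}^n (x_i + x̄_i)`. -/
def tsum {n : ℕ} (b : Tup n) : ℕ := ∑ i, (b.1 i + b.2 i)

/-- The element `(v,0,…,0)`. -/
def uvec (n v : ℕ) : Tup n := (fun j => if (j : ℕ) = 0 then v else 0, fun _ => 0)

/-- The element `(0,v,---,0)` (only `x_2 = v` nonzero). -/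
def u2vec (n v : ℕ) : Tup n := (fun j => if (j : ℕ) = 1 then v else 0, fun _ => 0)

/-- The element `(0,0,---,v)` (only `x̄_1 = v` nonzero). -/
def barvec (n v : ℕ) : Tup n := (fun _ => 0, fun j => if (j : ℕ) = 0 then v else 0)

/-- The element `(a,c,---,d)` with `x_1 = a`, `x_2 = c`, `x̄_1 = d`, all else `0`. -/
def tripleVec (n a c d : ℕ) : Tup n :=
  (fun j => if (j : ℕ) = 0 then a else if (j : ℕ) = 1 then c else 0,
   fun j => if (j : ℕ) = 0 then d else 0)

/-! ### The `U_q'(C_n^{(1)})` crystal `B_l` -/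

/-- Membership in the `C_n^{(1)}` crystal `B_l` : the sum of the entries belongs to
`{l, l-2, l-4, …}`. -/
def memC (n l : ℕ) (b : Tup n) : Prop := tsum b ≤ l ∧ (l - tsum b) % 2 = 0

def BC (n l : ℕ) : Set (Tup n) := {b | memC n l b}

/-- The number `x_0(b)` of `(0,0̄)` pairs. -/
def x0 (l : ℕ) {n : ℕ} (b : Tup n) : ℕ := (l - tsum b) / 2

/-- The operator `ẽ_i` on `B_l` (C case); `none` plays the role of `0`. -/
def eC (n l i : ℕ) (b : Tup n) : Option (Tup n) :=
  if i = 0 then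
    if 0 < n then
      if xbc b 1 + 2 ≤ xc b 1 then some (setx b.1 1 (xc b 1 - 2), b.2)
      else if xc b 1 = xbc b 1 + 1 then
        some (setx b.1 1 (xc b 1 - 1), setx b.2 1 (xbc b 1 + 1))
      else if tsum b + 2 ≤ l then some (b.1, setx b.2 1 (xbc b 1 + 2))
      else none
    else none
  else if i = n then
    if 0 < xbc b n then some (setx b.1 n (xc b n + 1), setx b.2 n (xbc b n - 1))
    else none
  else if i < n then
    if xbc b (i + 1) < xc b (i + 1) then
      some (setx (setx b.1 i (xc b i + 1)) (i + 1) (xc b (i + 1) - 1), b.2)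
    else if 0 < xbc b i then
      some (b.1, setx (setx b.2 (i + 1) (xbc b (i + 1) + 1)) i (xbc b i - 1))
    else none
  else none

/-- The operator `f̃_i` on `B_l` (C case). -/
def fC (n l i : ℕ) (b : Tup n) : Option (Tup n) :=
  if i = 0 then
    if 0 < n then
      if xbc b 1 ≤ xc b 1 then
        if tsum b + 2 ≤ l then some (setx b.1 1 (xc b 1 + 2), b.2) else none
      else if xc b 1 + 1 = xbc b 1 then
        some (setx b.1 1 (xc b 1 + 1), setx b.2 1 (xbc b 1 - 1))
      else some (b.1, setx b.2 1 (xbc b 1 - 2))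
    else none
  else if i = n then
    if 0 < xc b n then some (setx b.1 n (xc b n - 1), setx b.2 n (xbc b n + 1))
    else none
  else if i < n then
    if xbc b (i + 1) ≤ xc b (i + 1) then
      if 0 < xc b i then
        some (setx (setx b.1 i (xc b i - 1)) (i + 1) (xc b (i + 1) + 1), b.2)
      else none
    else some (b.1, setx (setx b.2 (i + 1) (xbc b (i + 1) - 1)) i (xbc b i + 1))
  else none

def eCIter (n l i m : ℕ) (b : Tup n) : Option (Tup n) :=
  (fun o => Option.bind o (eC n l i))^[m] (some b)

def fCIter (n l i m : ℕ) (b : Tup n) : Option (Tup n) :=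
  (fun o => Option.bind o (fC n l i))^[m] (some b)

/-- `ε_i(b) = max {m | ẽ_i^m b ≠ 0}` (C case). -/
noncomputable def epsC (n l i : ℕ) (b : Tup n) : ℕ :=
  sSup {m | eCIter n l i m b ≠ none}

/-- `φ_i(b) = max {m | f̃_i^m b ≠ 0}` (C case). -/
noncomputable def phiC (n l i : ℕ) (b : Tup n) : ℕ :=
  sSup {m | fCIter n l i m b ≠ none}

/-- `ẽ_i` on the tensor product `B_l ⊗ B_k` (C case). -/
noncomputable def eTenC (n l k i : ℕ) (u : Tup n × Tup n) : Option (Tup n × Tup n) :=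
  if epsC n k i u.2 ≤ phiC n l i u.1 then (eC n l i u.1).map (fun c => (c, u.2))
  else (eC n k i u.2).map (fun c => (u.1, c))

/-- `f̃_i` on the tensor product `B_l ⊗ B_k` (C case). -/
noncomputable def fTenC (n l k i : ℕ) (u : Tup n × Tup n) : Option (Tup n × Tup n) :=
  if epsC n k i u.2 < phiC n l i u.1 then (fC n l i u.1).map (fun c => (c, u.2))
  else (fC n k i u.2).map (fun c => (u.1, c))

/-- `ι : B_l ⊗ B_k → B_k ⊗ B_l` is an isomorphism of `U_q'(C_n^{(1)})` crystals. -/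
def IsIsoC (n l k : ℕ) (ι : Tup n × Tup n → Tup n × Tup n) : Prop :=
  Set.BijOn ι (BC n l ×ˢ BC n k) (BC n k ×ˢ BC n l) ∧
  ∀ u ∈ BC n l ×ˢ BC n k, ∀ i ≤ n,
    Option.map ι (eTenC n l k i u) = eTenC n k l i (ι u) ∧
    Option.map ι (fTenC n l k i u) = fTenC n k l i (ι u)

/-- `H` is an energy function for the isomorphism `ι` (C case), normalized by
`H((l,0,…,0) ⊗ (0,k,---,0)) = 0`. -/
def IsEnergyC (n l k : ℕ) (ι : Tup n × Tup n → Tup n × Tup n)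
    (H : Tup n × Tup n → ℤ) : Prop :=
  (∀ u ∈ BC n l ×ˢ BC n k, ∀ i ≤ n, ∀ v, eTenC n l k i u = some v →
      H v = H u +
        (if i = 0 then
          (if epsC n k 0 u.2 ≤ phiC n l 0 u.1 ∧ epsC n l 0 (ι u).2 ≤ phiC n k 0 (ι u).1
           then 1
           else if phiC n l 0 u.1 < epsC n k 0 u.2 ∧ phiC n k 0 (ι u).1 < epsC n l 0 (ι u).2
           then -1 else 0)
         else 0)) ∧
  H (uvec n l, u2vec n k) = 0

/-! ### The `U_q'(A_{2n-1}^{(2)})` crystal `B_l` -/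

def memA (n l : ℕ) (b : Tup n) : Prop := tsum b = l

def BA (n l : ℕ) : Set (Tup n) := {b | memA n l b}

/-- The operator `ẽ_i` (A case). -/
def eA (n i : ℕ) (b : Tup n) : Option (Tup n) :=
  if i = 0 then
    if 1 < n then
      if xbc b 2 < xc b 2 then some (setx b.1 2 (xc b 2 - 1), setx b.2 1 (xbc b 1 + 1))
      else if 0 < xc b 1 then some (setx b.1 1 (xc b 1 - 1), setx b.2 2 (xbc b 2 + 1))
      else none
    else none
  else if i = n then
    if 0 < xbc b n then some (setx b.1 n (xc b n + 1), setx b.2 n (xbc b n - 1))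
    else none
  else if i < n then
    if xbc b (i + 1) < xc b (i + 1) then
      some (setx (setx b.1 i (xc b i + 1)) (i + 1) (xc b (i + 1) - 1), b.2)
    else if 0 < xbc b i then
      some (b.1, setx (setx b.2 (i + 1) (xbc b (i + 1) + 1)) i (xbc b i - 1))
    else none
  else none

/-- The operator `f̃_i` (A case). -/
def fA (n i : ℕ) (b : Tup n) : Option (Tup n) :=
  if i = 0 then
    if 1 < n then
      if xbc b 2 ≤ xc b 2 then
        if 0 < xbc b 1 then some (setx b.1 2 (xc b 2 + 1), setx b.2 1 (xbc b 1 - 1))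
        else none
      else some (setx b.1 1 (xc b 1 + 1), setx b.2 2 (xbc b 2 - 1))
    else none
  else if i = n then
    if 0 < xc b n then some (setx b.1 n (xc b n - 1), setx b.2 n (xbc b n + 1))
    else none
  else if i < n then
    if xbc b (i + 1) ≤ xc b (i + 1) then
      if 0 < xc b i then
        some (setx (setx b.1 i (xc b i - 1)) (i + 1) (xc b (i + 1) + 1), b.2)
      else none
    else some (b.1, setx (setx b.2 (i + 1) (xbc b (i + 1) - 1)) i (xbc b i + 1))
  else none

def eAIter (n i m : ℕ) (b : Tup n) : Option (Tup n) :=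
  (fun o => Option.bind o (eA n i))^[m] (some b)

def fAIter (n i m : ℕ) (b : Tup n) : Option (Tup n) :=
  (fun o => Option.bind o (fA n i))^[m] (some b)

noncomputable def epsA (n i : ℕ) (b : Tup n) : ℕ :=
  sSup {m | eAIter n i m b ≠ none}

noncomputable def phiA (n i : ℕ) (b : Tup n) : ℕ :=
  sSup {m | fAIter n i m b ≠ none}

/-- `ẽ_i` on a tensor product (A case). -/
noncomputable def eTenA (n i : ℕ) (u : Tup n × Tup n) : Option (Tup n × Tup n) :=
  if epsA n i u.2 ≤ phiA n i u.1 then (eA n i u.1).map (fun c => (c, u.2))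
  else (eA n i u.2).map (fun c => (u.1, c))

/-- `f̃_i` on a tensor product (A case). -/
noncomputable def fTenA (n i : ℕ) (u : Tup n × Tup n) : Option (Tup n × Tup n) :=
  if epsA n i u.2 < phiA n i u.1 then (fA n i u.1).map (fun c => (c, u.2))
  else (fA n i u.2).map (fun c => (u.1, c))

/-- `ι : B_l ⊗ B_k → B_k ⊗ B_l` is an isomorphism of `U_q'(A_{2n-1}^{(2)})` crystals. -/
def IsIsoA (n l k : ℕ) (ι : Tup n × Tup n → Tup n × Tup n) : Prop :=
  Set.BijOn ι (BA n l ×ˢ BA n k) (BA n k ×ˢ BA n l) ∧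
  ∀ u ∈ BA n l ×ˢ BA n k, ∀ i ≤ n,
    Option.map ι (eTenA n i u) = eTenA n i (ι u) ∧
    Option.map ι (fTenA n i u) = fTenA n i (ι u)

/-- `H` is an energy function for `ι` (A case), normalized by
`H((l,0,…,0) ⊗ (0,0,---,k)) = 0`. -/
def IsEnergyA (n l k : ℕ) (ι : Tup n × Tup n → Tup n × Tup n)
    (H : Tup n × Tup n → ℤ) : Prop :=
  (∀ u ∈ BA n l ×ˢ BA n k, ∀ i ≤ n, ∀ v, eTenA n i u = some v →
      H v = H u +
        (if i = 0 then
          (if epsA n 0 u.2 ≤ phiA n 0 u.1 ∧ epsA n 0 (ι u).2 ≤ phiA n 0 (ι u).1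
           then 1
           else if phiA n 0 u.1 < epsA n 0 u.2 ∧ phiA n 0 (ι u).1 < epsA n 0 (ι u).2
           then -1 else 0)
         else 0)) ∧
  H (uvec n l, barvec n k) = 0

/-! ### Words, tableaux and column insertion

Letters are encoded as natural numbers: the unbarred letter `j` (for `0 ≤ j ≤ n`) is `j`,
and the barred letter `j̄` is `2n+1-j`; the natural order of `ℕ` is the order
`0 < 1 < ⋯ < n < n̄ < ⋯ < 1̄ < 0̄`.  A (two-row) tableau is encoded as the list of its
columns (left to right), each column being the list of its entries (top to bottom). -/

/-- The barred partner `j̄` of an unbarred letter `j`. -/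
def bar (n j : ℕ) : ℕ := 2 * n + 1 - j

/-- Column insertion of a letter into a tableau with at most two rows. -/
def insertLetter (n : ℕ) : ℕ → List (List ℕ) → List (List ℕ)
  | a, [] => [[a]]
  | a, [p] :: rest =>
      if a ≤ p then [a] :: insertLetter n p rest else [p, a] :: rest
  | a, [p, q] :: rest =>
      if p ≠ 0 ∧ p ≤ n ∧ q = bar n p ∧ p ≤ a ∧ a ≤ q then
        -- the column is a pair `(x, x̄)` with `x ≠ 0` and `x ≤ a ≤ x̄`
        [p - 1, a] :: insertLetter n (bar n (p - 1)) rest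
      else if n + 1 ≤ q ∧ bar n q < p ∧ p < q ∧ a = bar n q ∧ q ≠ n + 1 then
        -- the column is `(β, x̄)` with `x < β < x̄`, `a = x` and `x ≠ n`
        [a + 1, bar n (a + 1)] :: insertLetter n p rest
      else if a ≤ p then [a, q] :: insertLetter n p rest
      else if a ≤ q then [p, a] :: insertLetter n q rest
      else [p, q, a] :: rest
  | a, C :: rest => (C ++ [a]) :: rest

/-- Column insertion of a word `u = u_1 ⋯ u_j` into a tableau: `u_j` first, `u_1` last. -/
def insertWord (n : ℕ) (u : List ℕ) (T : List (List ℕ)) : List (List ℕ) :=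
  u.foldr (fun a T => insertLetter n a T) T

/-- One step of reverse insertion: letter `g` comes back (moving leftward) into a column;
returns the restored column together with the letter passed further left. -/
def revStep (n g : ℕ) (C : List ℕ) : List ℕ × ℕ :=
  match C with
  | [p] => ([g], p)
  | [p, q] =>
      if p ≠ 0 ∧ p ≤ n ∧ q = bar n p ∧ p ≤ g ∧ g ≤ q then
        ([g, bar n (p - 1)], p - 1)
      else if p ≤ n ∧ g = bar n p ∧ p < q ∧ q < g ∧ p ≠ n then
        ([p + 1, bar n (p + 1)], q)
      else if q ≤ g then ([p, g], q)
      else ([g, q], p)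
  | _ => (C, g)

/-- Reverse insertion of a letter through a list of columns, from right to left;
returns the new columns and the letter ejected from the leftmost column. -/
def revPass (n g : ℕ) : List (List ℕ) → List (List ℕ) × ℕ
  | [] => ([], g)
  | C :: rest =>
      let p := revPass n g rest
      let q := revStep n p.2 C
      (q.1 :: p.1, q.2)

/-- Reverse-bump the rightmost cell of the first row (the last column, a single box). -/
def rbFirst (n : ℕ) (T : List (List ℕ)) : List (List ℕ) × ℕ :=
  match T.getLast? with
  | some [a] => revPass n a T.dropLast
  | _ => (T, 0)

/-- Number of columns of height (at least) two, i.e. the length of the second row. -/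
def numTwoCols (T : List (List ℕ)) : ℕ :=
  (T.filter (fun C => decide (2 ≤ C.length))).length

/-- Reverse-bump the rightmost cell of the second row. -/
def rbSecond (n : ℕ) (T : List (List ℕ)) : List (List ℕ) × ℕ :=
  match (T.drop (numTwoCols T - 1)).head? with
  | some [a, b] =>
      let p := revPass n b (T.take (numTwoCols T - 1))
      (p.1 ++ [a] :: T.drop (numTwoCols T), p.2)
  | _ => (T, 0)

/-- Iterate a reverse-bumping step, collecting the ejected letters in order of ejection. -/
def rbIter (step : List (List ℕ) → List (List ℕ) × ℕ) :
    ℕ → List (List ℕ) → List (List ℕ) × List ℕ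
  | 0, T => (T, [])
  | c + 1, T =>
      let p := step T
      let q := rbIter step c p.1
      (q.1, p.2 :: q.2)

/-- A one-row word regarded as a tableau (list of one-box columns). -/
def rowCols (w : List ℕ) : List (List ℕ) := w.map (fun a => [a])

/-- The row word of a one-row tableau. -/
def colsWord (T : List (List ℕ)) : List ℕ := T.foldr (fun C acc => C ++ acc) []

/-- The word `1^{x_1} ⋯ n^{x_n} n̄^{x̄_n} ⋯ 1̄^{x̄_1}`. -/
def coreWord (n : ℕ) (b : Tup n) : List ℕ :=
  ((List.finRange n).map (fun i => List.replicate (b.1 i) ((i : ℕ) + 1))).foldr (· ++ ·) []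
  ++ ((List.finRange n).reverse.map
      (fun i => List.replicate (b.2 i) (bar n ((i : ℕ) + 1)))).foldr (· ++ ·) []

/-- The word `𝕋(b) = 0^{x_0} 1^{x_1} ⋯ 1̄^{x̄_1} 0̄^{x_0}` of an element of the
`C_n^{(1)}` crystal `B_l`. -/
def rowWordC (n l : ℕ) (b : Tup n) : List ℕ :=
  List.replicate (x0 l b) 0 ++ coreWord n b ++ List.replicate (x0 l b) (bar n 0)

/-- The word `𝕋(b)` with `z` pairs `(0, 0̄)` removed. -/
def hatWordC (n l z : ℕ) (b : Tup n) : List ℕ :=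
  List.replicate (x0 l b - z) 0 ++ coreWord n b ++ List.replicate (x0 l b - z) (bar n 0)

/-- The word `𝒯(b) = 1^{x_1} ⋯ 1̄^{x̄_1}` of an element of the `A_{2n-1}^{(2)}` crystal. -/
def rowWordA (n : ℕ) (b : Tup n) : List ℕ := coreWord n b



theorem sSup_iter {α : Type*} (g : α → Option α) (I : α → Prop) (μ : α → ℕ)
    (h1 : ∀ b b', I b → g b = some b' → I b' ∧ μ b = μ b' + 1)
    (h0 : ∀ b, I b → g b = none → μ b = 0) (b : α) (hb : I b) :
    sSup {m | (fun o => Option.bind o g)^[m] (some b) ≠ none} = μ b := by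
  have hnone : ∀ m, (fun o => Option.bind o g)^[m] none = none := by
    intro m
    induction m with
    | zero => rfl
    | succ m ih => rw [Function.iterate_succ_apply]; exact ih
  have key : ∀ m b, I b → ((fun o => Option.bind o g)^[m] (some b) ≠ none ↔ m ≤ μ b) := by
    intro m
    induction m with
    | zero => intro b _; simp
    | succ m ih =>
      intro b hb
      rw [Function.iterate_succ_apply]
      cases hg : g b with
      | none =>
        have := h0 b hb hg
        simp only [Option.bind_some, hg, hnone]
        simp; omega
      | some b' =>
        have := h1 b b' hb hg
        simp only [Option.bind_some, hg]
        rw [ih b' this.1]; omega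
  have : {m | (fun o => Option.bind o g)^[m] (some b) ≠ none} = Set.Iic (μ b) := by
    ext m; exact key m b hb
  rw [this, csSup_Iic]

theorem xc_set {n : ℕ} (f g : Fin n → ℕ) (j v i : ℕ) (hi : 1 ≤ i) (hin : i ≤ n) :
    xc (setx f j v, g) i = if i = j then v else xc (f, g) i := by
  have : i - 1 < n := by omega
  have h2 : i - 1 + 1 = i := by omega
  simp [xc, setx, this, h2]

theorem xbc_set {n : ℕ} (f g : Fin n → ℕ) (j v i : ℕ) (hi : 1 ≤ i) (hin : i ≤ n) :
    xbc (g, setx f j v) i = if i = j then v else xbc (g, f) i := by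
  have : i - 1 < n := by omega
  have h2 : i - 1 + 1 = i := by omega
  simp [xbc, setx, this, h2]

theorem xc_snd {n : ℕ} (f g : Fin n → ℕ) (j v i : ℕ) : xc (f, setx g j v) i = xc (f, g) i := rfl
theorem xbc_fst {n : ℕ} (f g : Fin n → ℕ) (j v i : ℕ) :
    xbc (setx f j v, g) i = xbc (f, g) i := rfl

theorem tsum_set1 {n : ℕ} (hn : 1 ≤ n) (b : Tup n) (v : ℕ) :
    tsum ((setx b.1 1 v, b.2) : Tup n) + xc b 1 = tsum b + v := by
  obtain ⟨m, rfl⟩ : ∃ m, n = m + 1 := ⟨n - 1, by omega⟩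
  simp [tsum, Fin.sum_univ_succ, setx, xc]
  omega

theorem tsum_set2 {n : ℕ} (hn : 1 ≤ n) (b : Tup n) (v : ℕ) :
    tsum ((b.1, setx b.2 1 v) : Tup n) + xbc b 1 = tsum b + v := by
  obtain ⟨m, rfl⟩ : ∃ m, n = m + 1 := ⟨n - 1, by omega⟩
  simp [tsum, Fin.sum_univ_succ, setx, xbc]
  omega

theorem tsum_ge1 {n : ℕ} (hn : 1 ≤ n) (b : Tup n) : xc b 1 + xbc b 1 ≤ tsum b := by
  obtain ⟨m, rfl⟩ : ∃ m, n = m + 1 := ⟨n - 1, by omega⟩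
  simp [tsum, Fin.sum_univ_succ, xbc, xc]

def nu0 (l : ℕ) {n : ℕ} (b : Tup n) : ℕ := x0 l b + (xc b 1 - xbc b 1)
def mu0 (l : ℕ) {n : ℕ} (b : Tup n) : ℕ := x0 l b + (xbc b 1 - xc b 1)

theorem e0_step (n l : ℕ) (hn : 1 ≤ n) (b b' : Tup n) (hb : memC n l b)
    (h : eC n l 0 b = some b') : memC n l b' ∧ nu0 l b = nu0 l b' + 1 := by
  have hg := tsum_ge1 hn b
  have ht1 := tsum_set1 hn b
  have ht2 := tsum_set2 hn b
  have ht3 := fun v w => tsum_set2 hn (setx b.1 1 v, b.2) w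
  obtain ⟨f, g⟩ := b
  simp only [memC] at hb
  simp only [eC, if_true, show 0 < n by omega] at h
  split_ifs at h with h1 h2 h3 <;> simp only [Option.some.injEq] at h <;> subst h <;>
    simp only [memC, nu0, x0, xc_set _ _ _ _ 1 le_rfl hn, xbc_set _ _ _ _ 1 le_rfl hn, if_true]
  · have := ht1 (xc (f, g) 1 - 2)
    simp only [xc_snd, xbc_fst] at *
    try dsimp only at *
    omega
  · have := ht1 (xc (f, g) 1 - 1)
    have := ht3 (xc (f, g) 1 - 1) (xbc (f, g) 1 + 1)
    simp only [xc_snd, xbc_fst] at *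
    try dsimp only at *
    omega
  · have := ht2 (xbc (f, g) 1 + 2)
    simp only [xc_snd, xbc_fst] at *
    try dsimp only at *
    omega

theorem f0_step (n l : ℕ) (hn : 1 ≤ n) (b b' : Tup n) (hb : memC n l b)
    (h : fC n l 0 b = some b') : memC n l b' ∧ mu0 l b = mu0 l b' + 1 := by
  have hg := tsum_ge1 hn b
  have ht1 := tsum_set1 hn b
  have ht2 := tsum_set2 hn b
  have ht3 := fun v w => tsum_set2 hn (setx b.1 1 v, b.2) w
  obtain ⟨f, g⟩ := b
  simp only [memC] at hb
  simp only [fC, if_true, show 0 < n by omega] at h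
  split_ifs at h with h1 h2 h3 <;> simp only [Option.some.injEq] at h <;> subst h <;>
    simp only [memC, mu0, x0, xc_set _ _ _ _ 1 le_rfl hn, xbc_set _ _ _ _ 1 le_rfl hn, if_true]
  · have := ht1 (xc (f, g) 1 + 2)
    simp only [xc_snd, xbc_fst] at *
    try dsimp only at *
    omega
  · have := ht1 (xc (f, g) 1 + 1)
    have := ht3 (xc (f, g) 1 + 1) (xbc (f, g) 1 - 1)
    simp only [xc_snd, xbc_fst] at *
    try dsimp only at *
    omega
  · have := ht2 (xbc (f, g) 1 - 2)
    simp only [xc_snd, xbc_fst] at *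
    try dsimp only at *
    omega

theorem eps0 (n l : ℕ) (hn : 1 ≤ n) (b : Tup n) (hb : memC n l b) :
    epsC n l 0 b = nu0 l b := by
  refine sSup_iter (eC n l 0) (memC n l) (nu0 l) (e0_step n l hn) ?_ b hb
  intro b hb h
  simp only [memC] at hb
  simp only [eC, if_true, show 0 < n by omega] at h
  split_ifs at h
  simp only [nu0, x0]
  omega

theorem phi0 (n l : ℕ) (hn : 1 ≤ n) (b : Tup n) (hb : memC n l b) :
    phiC n l 0 b = mu0 l b := by
  refine sSup_iter (fC n l 0) (memC n l) (mu0 l) (f0_step n l hn) ?_ b hb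
  intro b hb h
  simp only [memC] at hb
  simp only [fC, if_true, show 0 < n by omega] at h
  split_ifs at h
  simp only [mu0, x0]
  omega

theorem epsn (n l : ℕ) (hn : 1 ≤ n) (b : Tup n) :
    epsC n l n b = xbc b n := by
  refine sSup_iter (eC n l n) (fun _ => True) (fun b => xbc b n) ?_ ?_ b trivial
  · rintro ⟨f, g⟩ b' - h
    simp only [eC, if_true, show n ≠ 0 by omega, if_false] at h
    split_ifs at h <;> simp only [Option.some.injEq] at h
    subst h
    simp only [xbc_set _ _ _ _ n hn le_rfl, if_true, true_and]
    omega
  · rintro ⟨f, g⟩ - h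
    simp only [eC, if_true, show n ≠ 0 by omega, if_false] at h
    split_ifs at h
    omega

theorem epsi (n l i : ℕ) (hi : 1 ≤ i) (hin : i < n) (b : Tup n) :
    epsC n l i b = xbc b i + (xc b (i+1) - xbc b (i+1)) := by
  refine sSup_iter (eC n l i) (fun _ => True)
    (fun b => xbc b i + (xc b (i+1) - xbc b (i+1))) ?_ ?_ b trivial
  · rintro ⟨f, g⟩ b' - h
    simp only [eC, show i ≠ n by omega, show i ≠ 0 by omega, if_false, hin, if_true] at h
    split_ifs at h <;> simp only [Option.some.injEq] at h <;> subst h <;>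
      simp only [xbc_set _ _ _ _ i hi hin.le, xc_set _ _ _ _ i hi hin.le,
        xbc_set _ _ _ _ (i+1) (by omega) hin, xc_set _ _ _ _ (i+1) (by omega) hin, if_true,
        true_and, Nat.succ_ne_self, if_false, show i ≠ i + 1 by omega]
    · simp only [xc_snd, xbc_fst] at *; omega
    · simp only [xc_snd, xbc_fst] at *; omega
  · rintro ⟨f, g⟩ - h
    simp only [eC, show i ≠ n by omega, show i ≠ 0 by omega, if_false, hin, if_true] at h
    split_ifs at h
    omega

theorem phii (n l i : ℕ) (hi : 1 ≤ i) (hin : i < n) (b : Tup n) :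
    phiC n l i b = xc b i + (xbc b (i+1) - xc b (i+1)) := by
  refine sSup_iter (fC n l i) (fun _ => True)
    (fun b => xc b i + (xbc b (i+1) - xc b (i+1))) ?_ ?_ b trivial
  · rintro ⟨f, g⟩ b' - h
    simp only [fC, show i ≠ n by omega, show i ≠ 0 by omega, if_false, hin, if_true] at h
    split_ifs at h <;> simp only [Option.some.injEq] at h <;> subst h <;>
      simp only [xbc_set _ _ _ _ i hi hin.le, xc_set _ _ _ _ i hi hin.le,
        xbc_set _ _ _ _ (i+1) (by omega) hin, xc_set _ _ _ _ (i+1) (by omega) hin, if_true,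
        true_and, Nat.succ_ne_self, if_false, show i ≠ i + 1 by omega]
    · simp only [xc_snd, xbc_fst] at *; omega
    · simp only [xc_snd, xbc_fst] at *; omega
  · rintro ⟨f, g⟩ - h
    simp only [fC, show i ≠ n by omega, show i ≠ 0 by omega, if_false, hin, if_true] at h
    split_ifs at h
    omega

theorem phin (n l : ℕ) (hn : 1 ≤ n) (b : Tup n) :
    phiC n l n b = xc b n := by
  refine sSup_iter (fC n l n) (fun _ => True) (fun b => xc b n) ?_ ?_ b trivial
  · rintro ⟨f, g⟩ b' - h
    simp only [fC, if_true, show n ≠ 0 by omega, if_false] at h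
    split_ifs at h <;> simp only [Option.some.injEq] at h
    subst h
    simp only [xc_set _ _ _ _ n hn le_rfl, if_true, true_and]
    omega
  · rintro ⟨f, g⟩ - h
    simp only [fC, if_true, show n ≠ 0 by omega, if_false] at h
    split_ifs at h
    omega

theorem sum_one {n : ℕ} (i v : ℕ) (h : i < n) :
    ∑ x : Fin n, (if (x : ℕ) = i then v else 0) = v := by
  rw [Finset.sum_eq_single (⟨i, h⟩ : Fin n)]
  · simp
  · intro b _ hb
    rw [if_neg]
    intro h'
    exact hb (Fin.ext h')
  · simp

theorem sum_two {n : ℕ} (i i' s t : ℕ) (h : i < n) (h' : i' < n) (hne : i ≠ i') :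
    ∑ x : Fin n, (if (x : ℕ) = i then s else if (x : ℕ) = i' then t else 0) = s + t := by
  rw [← sum_one i s h, ← sum_one i' t h', ← Finset.sum_add_distrib]
  refine Finset.sum_congr rfl fun x _ => ?_
  rw [sum_one i s h, sum_one i' t h']
  split_ifs <;> omega

theorem sum_three {n : ℕ} (i i' j s t u : ℕ) (h : i < n) (h' : i' < n) (hj : j < n)
    (hne : i ≠ i') (h1 : i ≠ j) (h2 : i' ≠ j) :
    ∑ x : Fin n, (if (x : ℕ) = i then s else if (x : ℕ) = i' then t
      else if (x : ℕ) = j then u else 0) = s + t + u := by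
  rw [← sum_two i i' s t h h' hne, ← sum_one j u hj, ← Finset.sum_add_distrib]
  refine Finset.sum_congr rfl fun x _ => ?_
  rw [sum_one j u hj]
  split_ifs <;> omega

/-- four-entry vector -/
def V (n a c e d : ℕ) : Tup n :=
  (fun j => if (j : ℕ) = 0 then a else if (j : ℕ) = 1 then c else 0,
   fun j => if (j : ℕ) = 0 then d else if (j : ℕ) = 1 then e else 0)

theorem tsumV (n a c e d : ℕ) (hn : 2 ≤ n) : tsum (V n a c e d) = a + c + e + d := by
  simp only [tsum, V, Finset.sum_add_distrib]
  rw [sum_two 0 1 a c (by omega) (by omega) (by omega),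
    sum_two 0 1 d e (by omega) (by omega) (by omega)]
  omega

theorem xcV1 (n a c e d : ℕ) (hn : 2 ≤ n) : xc (V n a c e d) 1 = a := by
  simp [xc, V]; omega
theorem xcV2 (n a c e d : ℕ) (hn : 2 ≤ n) : xc (V n a c e d) 2 = c := by
  simp [xc, V]; omega
theorem xbcV1 (n a c e d : ℕ) (hn : 2 ≤ n) : xbc (V n a c e d) 1 = d := by
  simp [xbc, V]; omega
theorem xbcV2 (n a c e d : ℕ) (hn : 2 ≤ n) : xbc (V n a c e d) 2 = e := by
  simp [xbc, V]; omega

theorem setV1 (n a c e d v : ℕ) :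
    ((setx (V n a c e d).1 1 v, (V n a c e d).2) : Tup n) = V n v c e d := by
  refine Prod.ext (funext fun j => ?_) (funext fun j => ?_) <;> simp only [V, setx] <;>
    split_ifs <;> omega
theorem setVb1 (n a c e d v : ℕ) :
    (((V n a c e d).1, setx (V n a c e d).2 1 v) : Tup n) = V n a c e v := by
  refine Prod.ext (funext fun j => ?_) (funext fun j => ?_) <;> simp only [V, setx] <;>
    split_ifs <;> omega
theorem setV1b1 (n a c e d v w : ℕ) :
    ((setx (V n a c e d).1 1 v, setx (V n a c e d).2 1 w) : Tup n) = V n v c e w := by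
  refine Prod.ext (funext fun j => ?_) (funext fun j => ?_) <;> simp only [V, setx] <;>
    split_ifs <;> omega
theorem setV12 (n a c e d v w : ℕ) :
    ((setx (setx (V n a c e d).1 1 v) 2 w, (V n a c e d).2) : Tup n) = V n v w e d := by
  refine Prod.ext (funext fun j => ?_) (funext fun j => ?_) <;> simp only [V, setx] <;>
    split_ifs <;> omega
theorem setVb21 (n a c e d v w : ℕ) :
    (((V n a c e d).1, setx (setx (V n a c e d).2 2 v) 1 w) : Tup n) = V n a c v w := by
  refine Prod.ext (funext fun j => ?_) (funext fun j => ?_) <;> simp only [V, setx] <;>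
    split_ifs <;> omega

theorem e0V (n l a c e d : ℕ) (hn : 2 ≤ n) : eC n l 0 (V n a c e d) =
    if d + 2 ≤ a then some (V n (a - 2) c e d)
    else if a = d + 1 then some (V n (a - 1) c e (d + 1))
    else if a + c + e + d + 2 ≤ l then some (V n a c e (d + 2)) else none := by
  simp only [eC, if_true, show 0 < n by omega, xcV1 _ _ _ _ _ hn, xbcV1 _ _ _ _ _ hn,
    tsumV _ _ _ _ _ hn, setV1, setVb1, setV1b1]

theorem f0V (n l a c e d : ℕ) (hn : 2 ≤ n) : fC n l 0 (V n a c e d) =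
    if d ≤ a then if a + c + e + d + 2 ≤ l then some (V n (a + 2) c e d) else none
    else if a + 1 = d then some (V n (a + 1) c e (d - 1))
    else some (V n a c e (d - 2)) := by
  simp only [fC, if_true, show 0 < n by omega, xcV1 _ _ _ _ _ hn, xbcV1 _ _ _ _ _ hn,
    tsumV _ _ _ _ _ hn, setV1, setVb1, setV1b1]

theorem e1V (n l a c e d : ℕ) (hn : 2 ≤ n) : eC n l 1 (V n a c e d) =
    if e < c then some (V n (a + 1) (c - 1) e d)
    else if 0 < d then some (V n a c (e + 1) (d - 1)) else none := by
  simp only [eC, if_true, one_ne_zero, if_false, show 1 ≠ n by omega, show 1 < n by omega,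
    xcV1 _ _ _ _ _ hn, xbcV1 _ _ _ _ _ hn, Nat.reduceAdd,
    xcV2 _ _ _ _ _ hn, xbcV2 _ _ _ _ _ hn, setV12, setVb21]

theorem f1V (n l a c e d : ℕ) (hn : 2 ≤ n) : fC n l 1 (V n a c e d) =
    if e ≤ c then if 0 < a then some (V n (a - 1) (c + 1) e d) else none
    else some (V n a c (e - 1) (d + 1)) := by
  simp only [fC, if_true, one_ne_zero, if_false, show 1 ≠ n by omega, show 1 < n by omega,
    xcV1 _ _ _ _ _ hn, xbcV1 _ _ _ _ _ hn, Nat.reduceAdd,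
    xcV2 _ _ _ _ _ hn, xbcV2 _ _ _ _ _ hn, setV12, setVb21]

theorem eps1V (n l a c e d : ℕ) (hn : 2 ≤ n) : epsC n l 1 (V n a c e d) = d + (c - e) := by
  rw [epsi n l 1 le_rfl (by omega), xbcV1 _ _ _ _ _ hn, xcV2 _ _ _ _ _ hn, xbcV2 _ _ _ _ _ hn]

theorem phi1V (n l a c e d : ℕ) (hn : 2 ≤ n) : phiC n l 1 (V n a c e d) = a + (e - c) := by
  rw [phii n l 1 le_rfl (by omega), xcV1 _ _ _ _ _ hn, xcV2 _ _ _ _ _ hn, xbcV2 _ _ _ _ _ hn]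

theorem memV (n l a c e d : ℕ) (hn : 2 ≤ n) : memC n l (V n a c e d) ↔
    a + c + e + d ≤ l ∧ (l - (a + c + e + d)) % 2 = 0 := by
  rw [memC, tsumV _ _ _ _ _ hn]

theorem eps0V (n l a c e d : ℕ) (hn : 2 ≤ n) (h : memC n l (V n a c e d)) :
    epsC n l 0 (V n a c e d) = (l - (a + c + e + d)) / 2 + (a - d) := by
  rw [eps0 n l (by omega) _ h, nu0, x0, xcV1 _ _ _ _ _ hn, xbcV1 _ _ _ _ _ hn,
    tsumV _ _ _ _ _ hn]

theorem phi0V (n l a c e d : ℕ) (hn : 2 ≤ n) (h : memC n l (V n a c e d)) :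
    phiC n l 0 (V n a c e d) = (l - (a + c + e + d)) / 2 + (d - a) := by
  rw [phi0 n l (by omega) _ h, mu0, x0, xcV1 _ _ _ _ _ hn, xbcV1 _ _ _ _ _ hn,
    tsumV _ _ _ _ _ hn]

/-- iterated relation -/
def It {α : Type*} (r : α → α → Prop) : ℕ → α → α → Prop
  | 0, p, p' => p = p'
  | m + 1, p, p' => ∃ q, r p q ∧ It r m q p'

theorem It_add {α : Type*} (r : α → α → Prop) (m m' : ℕ) (p q s : α)
    (h : It r m p q) (h' : It r m' q s) : It r (m + m') p s := by
  induction m generalizing p with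
  | zero => cases h; simpa using h'
  | succ m ih =>
    obtain ⟨t, ht, ht'⟩ := h
    rw [show m + 1 + m' = (m + m') + 1 by omega]
    exact ⟨t, ht, ih t ht'⟩

def inB (n l k : ℕ) (p : Tup n × Tup n) : Prop := memC n l p.1 ∧ memC n k p.2

theorem inB_iff (n l k : ℕ) (p : Tup n × Tup n) : p ∈ BC n l ×ˢ BC n k ↔ inB n l k p := Iff.rfl

def S (n l k i : ℕ) (p p' : Tup n × Tup n) : Prop :=
  inB n l k p ∧ inB n l k p' ∧ fTenC n l k i p = some p' ∧ eTenC n l k i p' = some p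

def S0R (n l k : ℕ) (p p' : Tup n × Tup n) : Prop :=
  S n l k 0 p p' ∧ phiC n l 0 p'.1 < epsC n k 0 p'.2

theorem S_right (n l k i : ℕ) (X b b' : Tup n) (hX : memC n l X) (hb : memC n k b)
    (hb' : memC n k b') (h1 : fC n k i b = some b') (h2 : eC n k i b' = some b)
    (h3 : phiC n l i X ≤ epsC n k i b) (h4 : phiC n l i X < epsC n k i b') :
    S n l k i (X, b) (X, b') := by
  refine ⟨⟨hX, hb⟩, ⟨hX, hb'⟩, ?_, ?_⟩
  · simp only [fTenC]
    rw [if_neg (by omega), h1]; rfl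
  · simp only [eTenC]
    rw [if_neg (by omega), h2]; rfl

theorem S_left (n l k i : ℕ) (X b b' : Tup n) (hX : memC n k X) (hb : memC n l b)
    (hb' : memC n l b') (h1 : fC n l i b = some b') (h2 : eC n l i b' = some b)
    (h3 : epsC n k i X < phiC n l i b) (h4 : epsC n k i X ≤ phiC n l i b') :
    S n l k i (b, X) (b', X) := by
  refine ⟨⟨hb, hX⟩, ⟨hb', hX⟩, ?_, ?_⟩
  · simp only [fTenC]
    rw [if_pos h3, h1]; rfl
  · simp only [eTenC]
    rw [if_pos h4, h2]; rfl

theorem string (n l k : ℕ) (hn : 2 ≤ n) (X : Tup n) (hX : memC n l X) (hX0 : phiC n l 0 X = 0)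
    (N a c d : ℕ) (h : a + c + d ≤ k) (hp : (k - (a + c + d)) % 2 = 0)
    (hN : N = (k - (a + c + d)) / 2 + (d - a)) :
    It (S0R n l k) N (X, V n a c 0 d) (X, V n (k - c - min a d) c 0 (min a d)) := by
  have step : ∀ a d a' d', a + c + d ≤ k → (k - (a + c + d)) % 2 = 0 →
      a' + c + d' ≤ k → (k - (a' + c + d')) % 2 = 0 →
      fC n k 0 (V n a c 0 d) = some (V n a' c 0 d') →
      eC n k 0 (V n a' c 0 d') = some (V n a c 0 d) →
      0 < (k - (a' + c + d')) / 2 + (a' - d') →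
      S0R n l k (X, V n a c 0 d) (X, V n a' c 0 d') := by
    intro a d a' d' h1 h2 h1' h2' hf he hpos
    have hm : memC n k (V n a c 0 d) := (memV _ _ _ _ _ _ hn).2 ⟨h1, h2⟩
    have hm' : memC n k (V n a' c 0 d') := (memV _ _ _ _ _ _ hn).2 ⟨h1', h2'⟩
    have : phiC n l 0 X < epsC n k 0 (V n a' c 0 d') := by
      rw [eps0V _ _ _ _ _ _ hn hm']; omega
    exact ⟨S_right n l k 0 X _ _ hX hm hm' hf he (by omega) this, this⟩
  induction N generalizing a d with
  | zero =>
    have h1 : min a d = d := by omega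
    have h2 : k - c - d = a := by omega
    rw [h1, h2]; rfl
  | succ N ih =>
    by_cases h1 : d ≤ a
    · refine ⟨_, step a d (a + 2) d h hp (by omega) (by omega) ?_ ?_ (by omega), ?_⟩
      · rw [f0V _ _ _ _ _ _ hn, if_pos h1, if_pos (by omega)]
      · rw [e0V _ _ _ _ _ _ hn, if_pos (by omega)]; rfl
      · have := ih (a + 2) d (by omega) (by omega) (by omega)
        rwa [show min (a + 2) d = min a d by omega] at this
    · by_cases h2 : a + 1 = d
      · subst h2
        refine ⟨_, step a (a+1) (a + 1) a h hp (by omega) (by omega) ?_ ?_ (by omega), ?_⟩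
        · rw [f0V _ _ _ _ _ _ hn, if_neg h1, if_pos rfl]; rfl
        · rw [e0V _ _ _ _ _ _ hn, if_neg (by omega), if_pos rfl]; rfl
        · have := ih (a + 1) a (by omega) (by omega) (by omega)
          rwa [show min (a + 1) a = min a (a + 1) by omega] at this
      · refine ⟨_, step a d a (d - 2) h hp (by omega) (by omega) ?_ ?_ (by omega), ?_⟩
        · rw [f0V _ _ _ _ _ _ hn, if_neg h1, if_neg h2]
        · rw [e0V _ _ _ _ _ _ hn, if_neg (by omega), if_neg (by omega), if_pos (by omega),
            show d - 2 + 2 = d by omega]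
        · have := ih a (d - 2) (by omega) (by omega) (by omega)
          rwa [show min a (d - 2) = min a d by omega] at this

/-- left `f_1` moves -/
theorem left1 (n l k : ℕ) (hn : 2 ≤ n) (X : Tup n) (hX : memC n k X) (m a c : ℕ)
    (h : m + a + c = l) (hle : epsC n k 1 X ≤ a) :
    It (S n l k 1) m (V n (m + a) c 0 0, X) (V n a (c + m) 0 0, X) := by
  induction m generalizing c with
  | zero => simp [It]
  | succ m ih =>
    refine ⟨(V n (m + a) (c + 1) 0 0, X), ?_, ?_⟩
    · refine S_left n l k 1 X _ _ hX ((memV _ _ _ _ _ _ hn).2 ?_) ((memV _ _ _ _ _ _ hn).2 ?_)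
        ?_ ?_ ?_ ?_
      · omega
      · omega
      · rw [f1V _ _ _ _ _ _ hn, if_pos (by omega), if_pos (by omega),
          show m + 1 + a - 1 = m + a by omega]
      · rw [e1V _ _ _ _ _ _ hn, if_pos (by omega), show m + 1 + a = m + a + 1 by omega]; rfl
      · rw [phi1V _ _ _ _ _ _ hn]; omega
      · rw [phi1V _ _ _ _ _ _ hn]; omega
    · have := ih (c + 1) (by omega)
      rwa [show c + 1 + m = c + (m + 1) by omega] at this

/-- right `f_1` moves, unbarred -/
theorem right1 (n l k : ℕ) (hn : 2 ≤ n) (X : Tup n) (hX : memC n l X) (m a c d : ℕ)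
    (h : m + a + c + d = k) (hle : phiC n l 1 X ≤ c + d) :
    It (S n l k 1) m (X, V n (m + a) c 0 d) (X, V n a (c + m) 0 d) := by
  induction m generalizing c with
  | zero => simp [It]
  | succ m ih =>
    refine ⟨(X, V n (m + a) (c + 1) 0 d), ?_, ?_⟩
    · refine S_right n l k 1 X _ _ hX ((memV _ _ _ _ _ _ hn).2 ?_) ((memV _ _ _ _ _ _ hn).2 ?_)
        ?_ ?_ ?_ ?_
      · omega
      · omega
      · rw [f1V _ _ _ _ _ _ hn, if_pos (by omega), if_pos (by omega),
          show m + 1 + a - 1 = m + a by omega]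
      · rw [e1V _ _ _ _ _ _ hn, if_pos (by omega), show m + 1 + a = m + a + 1 by omega]; rfl
      · rw [eps1V _ _ _ _ _ _ hn]; omega
      · rw [eps1V _ _ _ _ _ _ hn]; omega
    · have := ih (c + 1) (by omega) (by omega)
      rwa [show c + 1 + m = c + (m + 1) by omega] at this

/-- right `f_1` moves, barred -/
theorem right1b (n l k : ℕ) (hn : 2 ≤ n) (X : Tup n) (hX : memC n l X) (m a d : ℕ)
    (h : m + a + d = k) (hle : phiC n l 1 X ≤ d) :
    It (S n l k 1) m (X, V n a 0 m d) (X, V n a 0 0 (d + m)) := by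
  induction m generalizing d with
  | zero => simp [It]
  | succ m ih =>
    refine ⟨(X, V n a 0 m (d + 1)), ?_, ?_⟩
    · refine S_right n l k 1 X _ _ hX ((memV _ _ _ _ _ _ hn).2 ?_) ((memV _ _ _ _ _ _ hn).2 ?_)
        ?_ ?_ ?_ ?_
      · omega
      · omega
      · rw [f1V _ _ _ _ _ _ hn, if_neg (by omega)]; rfl
      · rw [e1V _ _ _ _ _ _ hn, if_neg (by omega), if_pos (by omega)]; rfl
      · rw [eps1V _ _ _ _ _ _ hn]; omega
      · rw [eps1V _ _ _ _ _ _ hn]; omega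
    · have := ih (d + 1) (by omega) (by omega)
      rwa [show d + 1 + m = d + (m + 1) by omega] at this

/-- combined family of `f_1` moves -/
theorem fam1 (n l k : ℕ) (hn : 2 ≤ n) (a c d t : ℕ) (hk : a + c + d = k) (hl : c + d ≤ l)
    (ht : t ≤ a) :
    It (S n l k 1) (l - c - d + t) (V n l 0 0 0, V n a c 0 d)
      (V n (c + d) (l - c - d) 0 0, V n (a - t) (c + t) 0 d) := by
  have hm : memC n k (V n a c 0 d) := (memV _ _ _ _ _ _ hn).2 (by omega)
  have hm' : memC n l (V n (c + d) (l - c - d) 0 0) := (memV _ _ _ _ _ _ hn).2 (by omega)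
  refine It_add _ _ _ _ (V n (c + d) (l - c - d) 0 0, V n a c 0 d) _ ?_ ?_
  · have := left1 n l k hn _ hm (l - c - d) (c + d) 0 (by omega)
      (by rw [eps1V _ _ _ _ _ _ hn]; omega)
    rwa [show l - c - d + (c + d) = l by omega, Nat.zero_add] at this
  · have := right1 n l k hn _ hm' t (a - t) c d (by omega)
      (by rw [phi1V _ _ _ _ _ _ hn]; omega)
    rwa [show t + (a - t) = a by omega] at this

theorem fam2 (n l k : ℕ) (hn : 2 ≤ n) (j v : ℕ) (hk : j + v = k) :
    It (S n l k 1) (l + k) (V n l 0 0 0, V n j 0 v 0)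
      (V n 0 l 0 0, V n 0 j 0 v) := by
  have hm : memC n k (V n j 0 v 0) := (memV _ _ _ _ _ _ hn).2 (by omega)
  have hm' : memC n l (V n 0 l 0 0) := (memV _ _ _ _ _ _ hn).2 (by omega)
  refine It_add _ _ _ _ (V n 0 l 0 0, V n j 0 v 0) _ ?_ ?_
  · have := left1 n l k hn _ hm l 0 0 (by omega)
      (by rw [eps1V _ _ _ _ _ _ hn]; omega)
    rwa [Nat.zero_add] at this
  · rw [← hk, Nat.add_comm]
    refine It_add _ _ _ _ (V n 0 l 0 0, V n j 0 0 v) _ ?_ ?_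
    · have := right1b n l k hn _ hm' v j 0 (by omega)
        (by rw [phi1V _ _ _ _ _ _ hn]; omega)
      rwa [Nat.zero_add, ← hk, Nat.add_comm j v] at this
    · have := right1 n l k hn _ hm' j 0 0 v (by omega)
        (by rw [phi1V _ _ _ _ _ _ hn]; omega)
      rwa [Nat.zero_add, ← hk, Nat.add_comm j v] at this

def Er (n l k i : ℕ) (p p' : Tup n × Tup n) : Prop :=
  inB n l k p ∧ inB n l k p' ∧ eTenC n l k i p = some p'

def J (n l k : ℕ) (ι : Tup n × Tup n → Tup n × Tup n) (H : Tup n × Tup n → ℤ)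
    (p q : Tup n × Tup n) (h : ℤ) : Prop := inB n l k p ∧ ι p = q ∧ H p = h

theorem J_E {n l k : ℕ} {ι : Tup n × Tup n → Tup n × Tup n} {H : Tup n × Tup n → ℤ}
    (hι : IsIsoC n l k ι) (hH : IsEnergyC n l k ι H) (i : ℕ) (hi : 1 ≤ i) (hin : i ≤ n)
    (m : ℕ) (p q p' q' : Tup n × Tup n) (h : ℤ) (hJ : J n l k ι H p q h)
    (hp : It (Er n l k i) m p p') (hq : It (Er n k l i) m q q') : J n l k ι H p' q' h := by
  induction m generalizing p q with
  | zero => cases hp; cases hq; exact hJ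
  | succ m ih =>
    obtain ⟨r, ⟨h1, h2, h3⟩, hr⟩ := hp
    obtain ⟨s, ⟨g1, g2, g3⟩, hs⟩ := hq
    refine ih r s ⟨h2, ?_, ?_⟩ hr hs
    · have := (hι.2 p h1 i hin).1
      rw [h3, hJ.2.1, g3] at this
      simpa using this
    · have := hH.1 p h1 i hin r h3
      rw [if_neg (by omega), hJ.2.2] at this
      simpa using this

theorem J_f {n l k : ℕ} {ι : Tup n × Tup n → Tup n × Tup n} {H : Tup n × Tup n → ℤ}
    (hι : IsIsoC n l k ι) (hH : IsEnergyC n l k ι H) (i : ℕ) (hi : 1 ≤ i) (hin : i ≤ n)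
    (m : ℕ) (p q p' q' : Tup n × Tup n) (h : ℤ) (hJ : J n l k ι H p q h)
    (hp : It (S n l k i) m p p') (hq : It (S n k l i) m q q') : J n l k ι H p' q' h := by
  induction m generalizing p q with
  | zero => cases hp; cases hq; exact hJ
  | succ m ih =>
    obtain ⟨r, ⟨h1, h2, h3, h4⟩, hr⟩ := hp
    obtain ⟨s, ⟨g1, g2, g3, g4⟩, hs⟩ := hq
    refine ih r s ⟨h2, ?_, ?_⟩ hr hs
    · have := (hι.2 p h1 i hin).2
      rw [h3, hJ.2.1, g3] at this
      simpa using this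
    · have := hH.1 r h2 i hin p h4
      rw [if_neg (by omega), hJ.2.2] at this
      simpa using this.symm

theorem J_e {n l k : ℕ} {ι : Tup n × Tup n → Tup n × Tup n} {H : Tup n × Tup n → ℤ}
    (hι : IsIsoC n l k ι) (hH : IsEnergyC n l k ι H) (i : ℕ) (hi : 1 ≤ i) (hin : i ≤ n)
    (m : ℕ) (p q p' q' : Tup n × Tup n) (h : ℤ) (hJ : J n l k ι H p' q' h)
    (hp : It (S n l k i) m p p') (hq : It (S n k l i) m q q') : J n l k ι H p q h := by
  induction m generalizing p q with
  | zero => cases hp; cases hq; exact hJ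
  | succ m ih =>
    obtain ⟨r, ⟨h1, h2, h3, h4⟩, hr⟩ := hp
    obtain ⟨s, ⟨g1, g2, g3, g4⟩, hs⟩ := hq
    have hJ' := ih r s hr hs
    refine ⟨h1, ?_, ?_⟩
    · have := (hι.2 r h2 i hin).1
      rw [h4, hJ'.2.1, g4] at this
      simpa using this
    · have := hH.1 r h2 i hin p h4
      rw [if_neg (by omega), hJ'.2.2] at this
      simpa using this

theorem J_e0 {n l k : ℕ} {ι : Tup n × Tup n → Tup n × Tup n} {H : Tup n × Tup n → ℤ}
    (hι : IsIsoC n l k ι) (hH : IsEnergyC n l k ι H)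
    (m : ℕ) (p q p' q' : Tup n × Tup n) (h : ℤ) (hJ : J n l k ι H p' q' h)
    (hp : It (S0R n l k) m p p') (hq : It (S0R n k l) m q q') : J n l k ι H p q (h - m) := by
  induction m generalizing p q with
  | zero => cases hp; cases hq; simpa using hJ
  | succ m ih =>
    obtain ⟨r, ⟨⟨h1, h2, h3, h4⟩, h5⟩, hr⟩ := hp
    obtain ⟨s, ⟨⟨g1, g2, g3, g4⟩, g5⟩, hs⟩ := hq
    have hJ' := ih r s hr hs
    refine ⟨h1, ?_, ?_⟩
    · have := (hι.2 r h2 0 (by omega)).1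
      rw [h4, hJ'.2.1, g4] at this
      simpa using this
    · have := hH.1 r h2 0 (by omega) p h4
      rw [if_pos rfl, hJ'.2.1, if_neg (by omega), if_pos ⟨h5, g5⟩, hJ'.2.2] at this
      rw [this]; push_cast; ring

/-! ladder -/

def Q (n j p s t : ℕ) : Tup n :=
  (fun x => if (x : ℕ) = 0 then j else 0,
   fun x => if (x : ℕ) = p then s else if (x : ℕ) = p + 1 then t else 0)

def W (n j s t : ℕ) : Tup n :=
  (fun x => if (x : ℕ) = 0 then j else if (x : ℕ) = n - 1 then t else 0,
   fun x => if (x : ℕ) = n - 1 then s else 0)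

def P (n j p s t : ℕ) : Tup n :=
  (fun x => if (x : ℕ) = 0 then j else if (x : ℕ) = p then t
    else if (x : ℕ) = p + 1 then s else 0,
   fun _ => 0)

theorem Er_right (n l k i : ℕ) (b b' : Tup n) (hi : 2 ≤ i) (hin : i ≤ n)
    (hb : memC n k b) (hb' : memC n k b') (h2 : eC n k i b = some b')
    (h4 : 0 < epsC n k i b) :
    Er n l k i (V n l 0 0 0, b) (V n l 0 0 0, b') := by
  have hn : 2 ≤ n := by omega
  have hX : memC n l (V n l 0 0 0) := (memV _ _ _ _ _ _ hn).2 (by omega)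
  refine ⟨⟨hX, hb⟩, ⟨hX, hb'⟩, ?_⟩
  have : phiC n l i (V n l 0 0 0) = 0 := by
    rcases hin.lt_or_eq with h | rfl
    · rw [phii n l i (by omega) h]
      simp [xc, xbc, V]
      omega
    · rw [phin i l (by omega)]
      simp [xc, V]
      omega
  simp only [eTenC]
  rw [if_neg (by omega), h2]; rfl

theorem ladQ (n l k j p s t : ℕ) (hp : 1 ≤ p) (hpn : p + 1 < n) (hk : j + s + t = k) :
    It (Er n l k (p + 1)) s (V n l 0 0 0, Q n j p s t) (V n l 0 0 0, Q n j p 0 (t + s)) := by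
  have hm : ∀ s t, j + s + t = k → memC n k (Q n j p s t) := by
    intro s t h
    have : tsum (Q n j p s t) = k := by
      simp only [tsum, Q, Finset.sum_add_distrib]
      rw [sum_one 0 j (by omega), sum_two p (p + 1) s t (by omega) (by omega) (by omega)]
      omega
    simp only [memC, this]; omega
  induction s generalizing t with
  | zero => rfl
  | succ s ih =>
    refine ⟨(V n l 0 0 0, Q n j p s (t + 1)), ?_, ?_⟩
    · have e1 : xbc (Q n j p (s+1) t) (p + 1) = s + 1 := by
        simp [xbc, Q]; omega
      have e2 : xbc (Q n j p (s+1) t) (p + 1 + 1) = t := by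
        simp [xbc, Q]; omega
      have e3 : xc (Q n j p (s+1) t) (p + 1 + 1) = 0 := by
        simp [xc, Q]
      refine Er_right n l k _ _ _ (by omega) (by omega) (hm _ _ hk) (hm _ _ (by omega)) ?_ ?_
      · simp only [eC, e1, e2, e3]
        rw [if_neg (by omega), if_neg (by omega), if_pos hpn, if_neg (by omega), if_pos (by omega)]
        congr 1
        refine Prod.ext (funext fun x => ?_) (funext fun x => ?_) <;> simp only [Q, setx] <;>
          split_ifs <;> omega
      · rw [epsi n k _ (by omega) hpn, e1]; omega
    · have := ih (t + 1) (by omega)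
      rwa [show t + 1 + s = t + (s + 1) by omega] at this

theorem ladW (n l k j s t : ℕ) (hn : 2 ≤ n) (hk : j + s + t = k) :
    It (Er n l k n) s (V n l 0 0 0, W n j s t) (V n l 0 0 0, W n j 0 (t + s)) := by
  have hm : ∀ s t, j + s + t = k → memC n k (W n j s t) := by
    intro s t h
    have : tsum (W n j s t) = k := by
      simp only [tsum, W, Finset.sum_add_distrib]
      rw [sum_one (n - 1) s (by omega), sum_two 0 (n - 1) j t (by omega) (by omega) (by omega)]
      omega
    simp only [memC, this]; omega
  induction s generalizing t with
  | zero => rfl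
  | succ s ih =>
    refine ⟨(V n l 0 0 0, W n j s (t + 1)), ?_, ?_⟩
    · have e1 : xbc (W n j (s+1) t) n = s + 1 := by
        simp [xbc, W]; omega
      have e2 : xc (W n j (s+1) t) n = t := by
        simp [xc, W, show n - 1 ≠ 0 by omega]; omega
      refine Er_right n l k _ _ _ hn le_rfl (hm _ _ hk) (hm _ _ (by omega)) ?_ ?_
      · simp only [eC, e1, e2]
        rw [if_neg (by omega), if_pos trivial, if_pos (by omega)]
        congr 1
        refine Prod.ext (funext fun x => ?_) (funext fun x => ?_) <;> simp only [W, setx] <;>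
          split_ifs <;> omega
      · rw [epsn n k (by omega), e1]; omega
    · have := ih (t + 1) (by omega)
      rwa [show t + 1 + s = t + (s + 1) by omega] at this

theorem ladP (n l k j p s t : ℕ) (hp : 1 ≤ p) (hpn : p + 1 < n) (hk : j + s + t = k) :
    It (Er n l k (p + 1)) s (V n l 0 0 0, P n j p s t) (V n l 0 0 0, P n j p 0 (t + s)) := by
  have hm : ∀ s t, j + s + t = k → memC n k (P n j p s t) := by
    intro s t h
    have : tsum (P n j p s t) = k := by
      simp only [tsum, P, add_zero]
      rw [sum_three 0 p (p + 1) j t s (by omega) (by omega) (by omega) (by omega) (by omega)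
        (by omega)]
      omega
    simp only [memC, this]; omega
  induction s generalizing t with
  | zero => rfl
  | succ s ih =>
    refine ⟨(V n l 0 0 0, P n j p s (t + 1)), ?_, ?_⟩
    · have e1 : xc (P n j p (s+1) t) (p + 1) = t := by
        simp [xc, P, show p ≠ 0 by omega]; omega
      have e2 : xc (P n j p (s+1) t) (p + 1 + 1) = s + 1 := by
        simp [xc, P]; omega
      have e3 : xbc (P n j p (s+1) t) (p + 1 + 1) = 0 := by
        simp [xbc, P]
      refine Er_right n l k _ _ _ (by omega) (by omega) (hm _ _ hk) (hm _ _ (by omega)) ?_ ?_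
      · simp only [eC, e1, e2, e3]
        rw [if_neg (by omega), if_neg (by omega), if_pos hpn, if_pos (by omega)]
        congr 1
        refine Prod.ext (funext fun x => ?_) (funext fun x => ?_) <;> simp only [P, setx] <;>
          split_ifs <;> omega
      · rw [epsi n k _ (by omega) hpn, e2, e3]; omega
    · have := ih (t + 1) (by omega)
      rwa [show t + 1 + s = t + (s + 1) by omega] at this

theorem J_ladder {n l k : ℕ} {ι : Tup n × Tup n → Tup n × Tup n} {H : Tup n × Tup n → ℤ}
    (hn : 2 ≤ n) (hι : IsIsoC n l k ι) (hH : IsEnergyC n l k ι H) (j j' v : ℕ) (h : ℤ)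
    (hk : j + v = k) (hl : j' + v = l)
    (hJ : J n l k ι H (V n l 0 0 0, V n j 0 v 0) (V n k 0 0 0, V n j' 0 v 0) h) :
    J n l k ι H (V n l 0 0 0, V n j v 0 0) (V n k 0 0 0, V n j' v 0 0) h := by
  have hQ : ∀ p, 1 ≤ p → p < n →
      J n l k ι H (V n l 0 0 0, Q n j p v 0) (V n k 0 0 0, Q n j' p v 0) h := by
    intro p hp
    induction p, hp using Nat.le_induction with
    | base =>
      intro _
      have : ∀ j, Q n j 1 v 0 = V n j 0 v 0 := by
        intro j
        refine Prod.ext (funext fun x => ?_) (funext fun x => ?_) <;> simp only [Q, V] <;>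
          split_ifs <;> omega
      rw [this, this]; exact hJ
    | succ p hp ih =>
      intro hpn
      have := J_E hι hH (p + 1) (by omega) (by omega) v _ _ _ _ h (ih (by omega))
        (ladQ n l k j p v 0 hp hpn (by omega)) (ladQ n k l j' p v 0 hp hpn (by omega))
      have e : ∀ j, Q n j p 0 (0 + v) = Q n j (p + 1) v 0 := by
        intro j
        refine Prod.ext (funext fun x => ?_) (funext fun x => ?_) <;> simp only [Q] <;>
          split_ifs <;> omega
      rwa [e, e] at this
  have hW : J n l k ι H (V n l 0 0 0, W n j 0 v) (V n k 0 0 0, W n j' 0 v) h := by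
    have h1 := hQ (n - 1) (by omega) (by omega)
    have e : ∀ j, Q n j (n - 1) v 0 = W n j v 0 := by
      intro j
      refine Prod.ext (funext fun x => ?_) (funext fun x => ?_) <;> simp only [Q, W] <;>
          split_ifs <;> omega
    rw [e, e] at h1
    have := J_E hι hH n (by omega) le_rfl v _ _ _ _ h h1
        (ladW n l k j v 0 hn (by omega)) (ladW n k l j' v 0 hn (by omega))
    rwa [Nat.zero_add] at this
  have hP : ∀ m p, 1 ≤ p → p + m + 1 = n →
      J n l k ι H (V n l 0 0 0, P n j p 0 v) (V n k 0 0 0, P n j' p 0 v) h := by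
    intro m
    induction m with
    | zero =>
      intro p hp hpn
      have : ∀ j, W n j 0 v = P n j p 0 v := by
        intro j
        refine Prod.ext (funext fun x => ?_) (funext fun x => ?_) <;> simp only [W, P] <;>
          split_ifs <;> omega
      rw [← this, ← this]; exact hW
    | succ m ih =>
      intro p hp hpn
      have h1 := ih (p + 1) (by omega) (by omega)
      have e : ∀ j, P n j (p + 1) 0 v = P n j p v 0 := by
        intro j
        refine Prod.ext (funext fun x => ?_) (funext fun x => ?_) <;> simp only [P] <;>
          split_ifs <;> omega
      rw [e, e] at h1
      have := J_E hι hH (p + 1) (by omega) (by omega) v _ _ _ _ h h1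
        (ladP n l k j p v 0 hp (by omega) (by omega)) (ladP n k l j' p v 0 hp (by omega) (by omega))
      rwa [Nat.zero_add] at this
  have := hP (n - 2) 1 le_rfl (by omega)
  have e : ∀ j, P n j 1 0 v = V n j v 0 0 := by
    intro j
    refine Prod.ext (funext fun x => ?_) (funext fun x => ?_) <;> simp only [P, V] <;>
      split_ifs <;> omega
  rwa [e, e] at this

/-! anchor -/

theorem e0_some (n l : ℕ) (hn : 1 ≤ n) (b : Tup n) (hb : memC n l b) (h : nu0 l b ≠ 0) :
    ∃ b', eC n l 0 b = some b' := by
  cases h' : eC n l 0 b with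
  | some b' => exact ⟨b', rfl⟩
  | none =>
    exfalso; apply h
    simp only [memC] at hb
    simp only [eC, if_true, show 0 < n by omega] at h'
    split_ifs at h'
    simp only [nu0, x0]
    omega

theorem anchor_src (n l k : ℕ) (hn : 1 ≤ n) (N : ℕ) (p : Tup n × Tup n) (hp : inB n l k p)
    (hc : mu0 l p.1 = 0 ∨ nu0 k p.2 = 0) (hN : N = nu0 l p.1 + nu0 k p.2) :
    ∃ r, It (Er n l k 0) N p r := by
  induction N generalizing p with
  | zero => exact ⟨p, rfl⟩
  | succ N ih =>
    obtain ⟨b, X⟩ := p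
    obtain ⟨hb, hX⟩ := hp
    dsimp only at *
    by_cases h0 : nu0 k X = 0
    · obtain ⟨b', hb'⟩ := e0_some n l hn b hb (by omega)
      have h1 := e0_step n l hn b b' hb hb'
      obtain ⟨r, hr⟩ := ih (b', X) ⟨h1.1, hX⟩ (Or.inr h0) (by dsimp only; omega)
      refine ⟨r, (b', X), ⟨⟨hb, hX⟩, ⟨h1.1, hX⟩, ?_⟩, hr⟩
      simp only [eTenC]
      rw [if_pos (by rw [eps0 n k hn X hX]; omega), hb']; rfl
    · obtain ⟨b', hb'⟩ := e0_some n k hn X hX h0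
      have h1 := e0_step n k hn X b' hX hb'
      obtain ⟨r, hr⟩ := ih (b, b') ⟨hb, h1.1⟩ (Or.inl (by tauto)) (by dsimp only; omega)
      refine ⟨r, (b, b'), ⟨⟨hb, hX⟩, ⟨hb, h1.1⟩, ?_⟩, hr⟩
      simp only [eTenC]
      rw [if_neg (by rw [eps0 n k hn X hX, phi0 n l hn b hb]; have : mu0 l b = 0 := by tauto
                     omega), hb']; rfl

theorem anchor_tgt {n l k : ℕ} {ι : Tup n × Tup n → Tup n × Tup n} (hn : 1 ≤ n)
    (hι : IsIsoC n l k ι) (N : ℕ) (p r : Tup n × Tup n) (hp : inB n l k p)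
    (h : It (Er n l k 0) N p r) : N ≤ nu0 k (ι p).1 + nu0 l (ι p).2 := by
  induction N generalizing p with
  | zero => omega
  | succ N ih =>
    obtain ⟨s, ⟨h1, h2, h3⟩, hs⟩ := h
    have h4 := ih s h2 hs
    have h5 := (hι.2 p h1 0 (by omega)).1
    have h6 : inB n k l (ι p) := hι.1.mapsTo h1
    rw [h3] at h5
    generalize ι p = q at *
    simp only [eTenC, Option.map_some] at h5
    obtain ⟨q1, q2⟩ := q
    obtain ⟨h6, h7⟩ := h6
    dsimp only at *
    split_ifs at h5
    · cases h8 : eC n k 0 q1 with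
      | none => simp [h8] at h5
      | some b' =>
        simp [h8] at h5
        have := e0_step n k hn _ _ h6 h8
        rw [h5] at h4
        dsimp only at h4
        omega
    · cases h8 : eC n l 0 q2 with
      | none => simp [h8] at h5
      | some b' =>
        simp [h8] at h5
        have := e0_step n l hn _ _ h7 h8
        rw [h5] at h4
        dsimp only at h4
        omega

theorem nu0_le (n l : ℕ) (hn : 1 ≤ n) (b : Tup n) (hb : memC n l b) : nu0 l b ≤ l := by
  have := tsum_ge1 hn b
  simp only [memC] at hb
  simp only [nu0, x0]; omega

theorem nu0_eq (n l : ℕ) (hn : 1 ≤ n) (b : Tup n) (hb : memC n l b) (h : nu0 l b = l) :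
    b = V n l 0 0 0 := by
  have h1 := tsum_ge1 hn b
  simp only [memC] at hb
  simp only [nu0, x0] at h
  have h2 : xc b 1 = l := by omega
  have h3 : tsum b = l := by omega
  obtain ⟨m, rfl⟩ : ∃ m, n = m + 1 := ⟨n - 1, by omega⟩
  have h4 : b.1 0 = l := by simpa [xc] using h2
  simp only [tsum, Fin.sum_univ_succ] at h3
  have h5 : b.2 0 = 0 := by omega
  have h6 : ∑ i : Fin m, (b.1 i.succ + b.2 i.succ) = 0 := by omega
  rw [Finset.sum_eq_zero_iff] at h6
  refine Prod.ext (funext fun x => ?_) (funext fun x => ?_)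
  · refine Fin.cases ?_ (fun x => ?_) x
    · simpa [V] using h4
    · have := h6 x (Finset.mem_univ _)
      simp [V]; omega
  · refine Fin.cases ?_ (fun x => ?_) x
    · simpa [V] using h5
    · have := h6 x (Finset.mem_univ _)
      simp [V]; omega

theorem anchor {n l k : ℕ} {ι : Tup n × Tup n → Tup n × Tup n} (hn : 2 ≤ n)
    (hι : IsIsoC n l k ι) :
    ι (V n l 0 0 0, V n k 0 0 0) = (V n k 0 0 0, V n l 0 0 0) := by
  have hB : ∀ l, memC n l (V n l 0 0 0) := fun l => (memV _ _ _ _ _ _ hn).2 (by omega)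
  have hp : inB n l k (V n l 0 0 0, V n k 0 0 0) := ⟨hB l, hB k⟩
  have hnu : ∀ l, nu0 l (V n l 0 0 0) = l := by
    intro l
    rw [← eps0 n l (by omega) _ (hB l), eps0V _ _ _ _ _ _ hn (hB l)]; omega
  have hmu : mu0 l (V n l 0 0 0) = 0 := by
    rw [← phi0 n l (by omega) _ (hB l), phi0V _ _ _ _ _ _ hn (hB l)]; omega
  obtain ⟨r, hr⟩ := anchor_src n l k (by omega) (l + k) _ hp (Or.inl hmu)
    (by dsimp only; rw [hnu, hnu])
  have h1 := anchor_tgt (by omega) hι _ _ _ hp hr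
  obtain ⟨h2, h3⟩ : inB n k l (ι (V n l 0 0 0, V n k 0 0 0)) := hι.1.mapsTo hp
  have h4 := nu0_le n k (by omega) _ h2
  have h5 := nu0_le n l (by omega) _ h3
  exact Prod.ext (nu0_eq n k (by omega) _ h2 (by omega)) (nu0_eq n l (by omega) _ h3 (by omega))

/-- bottoms with `m = 0`, up to normalization -/
theorem bot0 {n l k : ℕ} {ι : Tup n × Tup n → Tup n × Tup n} {H : Tup n × Tup n → ℤ}
    (hn : 2 ≤ n) (hkl : k ≤ l) (hι : IsIsoC n l k ι) (hH : IsEnergyC n l k ι H)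
    (c : ℕ) (hc : c ≤ k) :
    J n l k ι H (V n l 0 0 0, V n (k - c) c 0 0) (V n k 0 0 0, V n (l - c) c 0 0)
      (H (V n l 0 0 0, V n k 0 0 0) - c) := by
  have hB : ∀ l, memC n l (V n l 0 0 0) := fun l => (memV _ _ _ _ _ _ hn).2 (by omega)
  have hB2 : ∀ l, memC n l (V n 0 l 0 0) := fun l => (memV _ _ _ _ _ _ hn).2 (by omega)
  have hphi : ∀ l, phiC n l 0 (V n 0 l 0 0) = 0 := by
    intro l
    rw [phi0V _ _ _ _ _ _ hn (hB2 l)]; omega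
  have h0 : J n l k ι H (V n l 0 0 0, V n k 0 0 0) (V n k 0 0 0, V n l 0 0 0)
    (H (V n l 0 0 0, V n k 0 0 0)) := ⟨⟨hB l, hB k⟩, anchor hn hι, rfl⟩
  have p1 := fam1 n l k hn k 0 0 (k - c) (by omega) (by omega) (by omega)
  have q1 := fam1 n k l hn l 0 0 (l - c) (by omega) (by omega) (by omega)
  simp only [Nat.zero_add, Nat.sub_zero, show k - (k - c) = c by omega,
    show l - (l - c) = c by omega, show k + (l - c) = l + (k - c) by omega] at p1 q1
  have h1 := J_f hι hH 1 le_rfl (by omega) _ _ _ _ _ _ h0 p1 q1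
  have p2 := string n l k hn (V n 0 l 0 0) (hB2 l) (hphi l) c 0 (k - c) c
    (by omega) (by omega) (by omega)
  have q2 := string n k l hn (V n 0 k 0 0) (hB2 k) (hphi k) c 0 (l - c) c
    (by omega) (by omega) (by omega)
  simp only [Nat.zero_min, Nat.sub_zero, show k - (k - c) = c by omega,
    show l - (l - c) = c by omega] at p2 q2
  have h2 := J_e0 hι hH _ _ _ _ _ _ h1 p2 q2
  have p3 := fam2 n l k hn (k - c) c (by omega)
  have q3 := fam2 n k l hn (l - c) c (by omega)
  rw [Nat.add_comm k l] at q3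
  have h3 := J_e hι hH 1 le_rfl (by omega) _ _ _ _ _ _ h2 p3 q3
  exact J_ladder hn hι hH _ _ _ _ (by omega) (by omega) h3

theorem bot {n l k : ℕ} {ι : Tup n × Tup n → Tup n × Tup n} {H : Tup n × Tup n → ℤ}
    (hn : 2 ≤ n) (hkl : k ≤ l) (hι : IsIsoC n l k ι) (hH : IsEnergyC n l k ι H)
    (c m : ℕ) (hc : c + 2 * m ≤ k) :
    J n l k ι H (V n l 0 0 0, V n (k - c - m) c 0 m) (V n k 0 0 0, V n (l - c - m) c 0 m)
      (H (V n l 0 0 0, V n k 0 0 0) - c - 2 * m) := by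
  have hB2 : ∀ l a c, a + c = l → memC n l (V n a c 0 0) :=
    fun l a c h => (memV _ _ _ _ _ _ hn).2 (by omega)
  have hphi : ∀ l a c, a + c = l → phiC n l 0 (V n a c 0 0) = 0 := by
    intro l a c h
    rw [phi0V _ _ _ _ _ _ hn (hB2 l a c h)]; omega
  have h0 := bot0 hn hkl hι hH (c + m) (by omega)
  have p1 := fam1 n l k hn (k - (c + m)) (c + m) 0 (k - c - 2 * m)
    (by omega) (by omega) (by omega)
  have q1 := fam1 n k l hn (l - (c + m)) (c + m) 0 (l - c - 2 * m)
    (by omega) (by omega) (by omega)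
  rw [show k - (c + m) - 0 + (l - c - 2 * m) = l - (c + m) - 0 + (k - c - 2 * m) by omega,
    show l - (c + m) - (l - c - 2 * m) = m by omega,
    show c + m + (l - c - 2 * m) = l - m by omega] at q1
  rw [show k - (c + m) - (k - c - 2 * m) = m by omega,
    show c + m + (k - c - 2 * m) = k - m by omega] at p1
  have h1 := J_f hι hH 1 le_rfl (by omega) _ _ _ _ _ _ h0 p1 q1
  simp only [Nat.add_zero, Nat.sub_zero] at h1
  have p2 := string n l k hn (V n (c + m) (l - (c + m)) 0 0) (hB2 l _ _ (by omega))
    (hphi l _ _ (by omega)) m 0 (k - m) m (by omega) (by omega) (by omega)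
  have q2 := string n k l hn (V n (c + m) (k - (c + m)) 0 0) (hB2 k _ _ (by omega))
    (hphi k _ _ (by omega)) m 0 (l - m) m (by omega) (by omega) (by omega)
  simp only [Nat.zero_min, Nat.sub_zero, show k - (k - m) = m by omega,
    show l - (l - m) = m by omega] at p2 q2
  have h2 := J_e0 hι hH _ _ _ _ _ _ h1 p2 q2
  have p3 := fam1 n l k hn (k - (c + m)) c m (k - (c + m))
    (by omega) (by omega) (by omega)
  have q3 := fam1 n k l hn (l - (c + m)) c m (l - (c + m))
    (by omega) (by omega) (by omega)
  rw [show l - c - m = l - (c + m) by omega, Nat.sub_self,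
    show c + (k - (c + m)) = k - m by omega] at p3
  rw [show k - c - m = k - (c + m) by omega,
    show k - (c + m) + (l - (c + m)) = l - (c + m) + (k - (c + m)) by omega, Nat.sub_self,
    show c + (l - (c + m)) = l - m by omega] at q3
  have h3 := J_e hι hH 1 le_rfl (by omega) _ _ _ _ _ _ h2 p3 q3
  rw [show k - c - m = k - (c + m) by omega, show l - c - m = l - (c + m) by omega]
  refine ⟨h3.1, h3.2.1, ?_⟩
  rw [h3.2.2]; push_cast; ring

/-- **Lemma 4.3** (type I highest elements).  With `x₀ = (k - x_1 - x_2 - x̄_1)/2` and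
`y = min(l-k, (x̄_1 - x_1)_+)`, the isomorphism maps
`(l,0,…,0) ⊗ (x_1,x_2,---,x̄_1)` to `(k,0,…,0) ⊗ (x_1+l-k-y, x_2, ---, x̄_1-y)`, and the
energy equals `x₀ + (x_1 - x̄_1)_+`. -/
theorem lemma_4_3
    (n l k : ℕ) (hn : 2 ≤ n) (hk : 1 ≤ k) (hkl : k ≤ l)
    (ι : Tup n × Tup n → Tup n × Tup n) (hι : IsIsoC n l k ι)
    (H : Tup n × Tup n → ℤ) (hH : IsEnergyC n l k ι H)
    (a c d : ℕ) (hsum : a + c + d ≤ k) (hpar : (k - (a + c + d)) % 2 = 0)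
    (x₀ y : ℕ) (hx0 : x₀ = (k - (a + c + d)) / 2) (hy : y = min (l - k) (d - a)) :
    ι (uvec n l, tripleVec n a c d) =
      (uvec n k, tripleVec n (a + (l - k) - y) c (d - y)) ∧
    H (uvec n l, tripleVec n a c d) = (x₀ : ℤ) + ((a - d : ℕ) : ℤ) := by
  have hB : ∀ l, memC n l (V n l 0 0 0) := fun l => (memV _ _ _ _ _ _ hn).2 (by omega)
  have hphi : ∀ l, phiC n l 0 (V n l 0 0 0) = 0 := by
    intro l
    rw [phi0V _ _ _ _ _ _ hn (hB l)]; omega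
  have hu : ∀ l, uvec n l = V n l 0 0 0 := by
    intro l
    refine Prod.ext (funext fun x => ?_) (funext fun x => ?_) <;> simp only [uvec, V] <;>
      split_ifs <;> omega
  have hu2 : u2vec n k = V n 0 k 0 0 := by
    refine Prod.ext (funext fun x => ?_) (funext fun x => ?_) <;> simp only [u2vec, V] <;>
      split_ifs <;> omega
  have ht : ∀ a c d, tripleVec n a c d = V n a c 0 d := by
    intro a c d
    refine Prod.ext (funext fun x => ?_) (funext fun x => ?_) <;> simp only [tripleVec, V] <;>
      split_ifs <;> omega
  have hnorm : H (V n l 0 0 0, V n k 0 0 0) = k := by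
    have h1 := (bot0 hn hkl hι hH k le_rfl).2.2
    have h2 := hH.2
    rw [hu, hu2] at h2
    rw [Nat.sub_self, h2] at h1
    omega
  have h0 := bot hn hkl hι hH c (min a d) (by omega)
  have p := string n l k hn (V n l 0 0 0) (hB l) (hphi l) (x₀ + (d - a)) a c d
    hsum hpar (by omega)
  have q := string n k l hn (V n k 0 0 0) (hB k) (hphi k) (x₀ + (d - a)) (a + (l - k) - y) c (d - y)
    (by omega) (by omega) (by omega)
  rw [show min (a + (l - k) - y) (d - y) = min a d by omega] at q
  have h1 := J_e0 hι hH _ _ _ _ _ _ h0 p q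
  rw [hu, hu, ht, ht]
  refine ⟨h1.2.1, ?_⟩
  rw [h1.2.2, hnorm]
  omega

end KTT
end

section
/- Corollary 4.4: Let n ≥ 2 and l, k ≥ 1. For any isomorphism ι : B_l ⊗ B_k → B_k ⊗ B_l of U_q'(C_n^(1)) crystals and any energy function H for ι, one has H((l,0,…,0) ⊗ (k,0,…,0)) = min(l, k). -/
namespace KTT

/-! ### Auxiliary material for the proof -/

theorem aux_sup {α : Type*} (g : α → Option α) (S : α → Prop) (P : α → ℕ)
    (h0 : ∀ b, S b → g b = none → P b = 0)
    (h1 : ∀ b b', S b → g b = some b' → S b' ∧ P b = P b' + 1) (b : α) (hb : S b) :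
    sSup {m | (fun o => Option.bind o g)^[m] (some b) ≠ none} = P b := by
  have hnone : ∀ m, (fun o => Option.bind o g)^[m] none = none := by
    intro m
    induction m with
    | zero => rfl
    | succ m ih => rw [Function.iterate_succ_apply]; exact ih
  have key : ∀ m b, S b → ((fun o => Option.bind o g)^[m] (some b) ≠ none ↔ m ≤ P b) := by
    intro m
    induction m with
    | zero => intro b _; simp
    | succ m ih =>
      intro b hb
      rw [Function.iterate_succ_apply]
      change ((fun o => Option.bind o g)^[m] (g b) ≠ none ↔ _)
      cases hg : g b with
      | none => rw [hnone, h0 b hb hg]; simp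
      | some b' =>
        obtain ⟨hs, hp⟩ := h1 b b' hb hg
        rw [ih b' hs, hp]; omega
  have : {m | (fun o => Option.bind o g)^[m] (some b) ≠ none} = Set.Iic (P b) := by
    ext m; exact key m b hb
  rw [this, csSup_Iic]

/-- entry of a vector -/
def ent {n : ℕ} (f : Fin n → ℕ) (j : ℕ) : ℕ := if h : j - 1 < n then f ⟨j - 1, h⟩ else 0

/-- weighted sum -/
def wsum {n : ℕ} (w : ℕ → ℕ) (f : Fin n → ℕ) : ℕ := ∑ t : Fin n, w (t : ℕ) * f t

theorem ent_setx {n : ℕ} (f : Fin n → ℕ) (j v j' : ℕ) (h1 : 1 ≤ j') (h2 : j' ≤ n) :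
    ent (setx f j v) j' = if j' = j then v else ent f j' := by
  unfold ent setx
  have : j' - 1 < n := by omega
  have e : j' - 1 + 1 = j' := by omega
  simp [this, e]

theorem wsum_setx {n : ℕ} (w : ℕ → ℕ) (f : Fin n → ℕ) (j v : ℕ) (h1 : 1 ≤ j) (h2 : j ≤ n) :
    wsum w (setx f j v) + w (j - 1) * ent f j = wsum w f + w (j - 1) * v := by
  have hj : j - 1 < n := by omega
  unfold wsum
  rw [← Finset.add_sum_erase Finset.univ (fun t : Fin n => w (t : ℕ) * setx f j v t)
      (Finset.mem_univ (⟨j - 1, hj⟩ : Fin n)),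
    ← Finset.add_sum_erase Finset.univ (fun t : Fin n => w (t : ℕ) * f t)
      (Finset.mem_univ (⟨j - 1, hj⟩ : Fin n))]
  have hs : ∑ t ∈ Finset.univ.erase (⟨j - 1, hj⟩ : Fin n), w (t : ℕ) * setx f j v t
      = ∑ t ∈ Finset.univ.erase (⟨j - 1, hj⟩ : Fin n), w (t : ℕ) * f t := by
    apply Finset.sum_congr rfl
    intro t ht
    have hne : t ≠ ⟨j - 1, hj⟩ := (Finset.mem_erase.mp ht).1
    have : ¬ ((t : ℕ) + 1 = j) := by
      intro h; apply hne; ext; simp; omega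
    simp [setx, this]
  rw [hs]
  have e : j - 1 + 1 = j := by omega
  simp only [setx, ent, hj, e, if_true, dif_pos]
  ring

theorem ssum_setx {n : ℕ} (f : Fin n → ℕ) (j v : ℕ) (h1 : 1 ≤ j) (h2 : j ≤ n) :
    wsum (fun _ => 1) (setx f j v) + ent f j = wsum (fun _ => 1) f + v := by
  simpa using wsum_setx (fun _ => 1) f j v h1 h2

theorem ent_le {n : ℕ} (f : Fin n → ℕ) (j : ℕ) (h1 : 1 ≤ j) (h2 : j ≤ n) :
    ent f j ≤ wsum (fun _ => 1) f := by
  have := ssum_setx f j 0 h1 h2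
  omega

theorem tsum_eq {n : ℕ} (b : Tup n) :
    tsum b = wsum (fun _ => 1) b.1 + wsum (fun _ => 1) b.2 := by
  simp [tsum, wsum, Finset.sum_add_distrib]

theorem xc_eq {n : ℕ} (b : Tup n) (j : ℕ) : xc b j = ent b.1 j := rfl
theorem xbc_eq {n : ℕ} (b : Tup n) (j : ℕ) : xbc b j = ent b.2 j := rfl

/-- formula for `ε_i` -/
def EE (n l i : ℕ) (b : Tup n) : ℕ :=
  if i = 0 then (l - tsum b) / 2 + (xc b 1 - xbc b 1)
  else if i = n then xbc b n
  else xbc b i + (xc b (i + 1) - xbc b (i + 1))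

/-- formula for `φ_i` -/
def FF (n l i : ℕ) (b : Tup n) : ℕ :=
  if i = 0 then (l - tsum b) / 2 + (xbc b 1 - xc b 1)
  else if i = n then xc b n
  else xc b i + (xbc b (i + 1) - xc b (i + 1))

theorem e_none {n l i : ℕ} (hn : 2 ≤ n) (hi : i ≤ n) (b : Tup n) (h : eC n l i b = none) :
    EE n l i b = 0 := by
  unfold eC at h
  unfold EE
  split_ifs at h ⊢ <;> simp_all <;> omega

theorem f_none {n l i : ℕ} (hn : 2 ≤ n) (hi : i ≤ n) (b : Tup n) (h : fC n l i b = none) :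
    FF n l i b = 0 := by
  unfold fC at h
  unfold FF
  split_ifs at h ⊢ <;> simp_all <;> omega

theorem e_some {n l i : ℕ} (hn : 2 ≤ n) (hi : i ≤ n) (b b' : Tup n) (hb : b ∈ BC n l)
    (h : eC n l i b = some b') : b' ∈ BC n l ∧ EE n l i b = EE n l i b' + 1 := by
  obtain ⟨f, g⟩ := b
  have hb' : tsum (f, g) ≤ l ∧ (l - tsum (f, g)) % 2 = 0 := hb
  change memC n l b' ∧ _
  unfold eC at h
  unfold EE memC
  have hn1 : 1 ≤ n := by omega
  by_cases h1 : i = 0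
  · rw [if_pos h1, if_pos (show 0 < n by omega)] at h
    by_cases h3 : xbc (f, g) 1 + 2 ≤ xc (f, g) 1
    · rw [if_pos h3] at h
      obtain rfl := Option.some.inj h; clear h; simp only [tsum_eq, xc_eq, xbc_eq] at *
      subst h1
      have a1 := ssum_setx f 1 (ent f 1 - 2) le_rfl hn1
      have a2 := ent_le f 1 le_rfl hn1
      simp [ent_setx, hn1]
      omega
    rw [if_neg h3] at h
    by_cases h4 : xc (f, g) 1 = xbc (f, g) 1 + 1
    · rw [if_pos h4] at h
      obtain rfl := Option.some.inj h; clear h; simp only [tsum_eq, xc_eq, xbc_eq] at *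
      subst h1
      have a1 := ssum_setx f 1 (ent f 1 - 1) le_rfl hn1
      have a3 := ssum_setx g 1 (ent g 1 + 1) le_rfl hn1
      have a2 := ent_le f 1 le_rfl hn1
      simp [ent_setx, hn1]
      omega
    rw [if_neg h4] at h
    by_cases h5 : tsum (f, g) + 2 ≤ l
    · rw [if_pos h5] at h
      obtain rfl := Option.some.inj h; clear h; simp only [tsum_eq, xc_eq, xbc_eq] at *
      subst h1
      have a3 := ssum_setx g 1 (ent g 1 + 2) le_rfl hn1
      simp [ent_setx, hn1]
      omega
    · rw [if_neg h5] at h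
      exact absurd h (by simp)
  rw [if_neg h1] at h
  by_cases h6 : i = n
  · rw [if_pos h6] at h
    by_cases h7 : 0 < xbc (f, g) n
    · rw [if_pos h7] at h
      obtain rfl := Option.some.inj h; clear h; simp only [tsum_eq, xc_eq, xbc_eq] at *
      subst h6
      have a1 := ssum_setx f i (ent f i + 1) hn1 le_rfl
      have a3 := ssum_setx g i (ent g i - 1) hn1 le_rfl
      have a2 := ent_le g i hn1 le_rfl
      simp [ent_setx, hn1, h1]
      omega
    · rw [if_neg h7] at h
      exact absurd h (by simp)
  rw [if_neg h6, if_pos (show i < n by omega)] at h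
  by_cases h8 : xbc (f, g) (i + 1) < xc (f, g) (i + 1)
  · rw [if_pos h8] at h
    obtain rfl := Option.some.inj h; clear h; simp only [tsum_eq, xc_eq, xbc_eq] at *
    have i1 : 1 ≤ i := by omega
    have i2 : i + 1 ≤ n := by omega
    have a1 := ssum_setx f i (ent f i + 1) i1 hi
    have a3 := ssum_setx (setx f i (ent f i + 1)) (i+1) (ent f (i+1) - 1) (by omega) i2
    have a2 := ent_le f (i+1) (by omega) i2
    simp [ent_setx, h1, h6, i1, hi, i2] at a3 ⊢
    omega
  rw [if_neg h8] at h
  by_cases h9 : 0 < xbc (f, g) i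
  · rw [if_pos h9] at h
    obtain rfl := Option.some.inj h; clear h; simp only [tsum_eq, xc_eq, xbc_eq] at *
    have i1 : 1 ≤ i := by omega
    have i2 : i + 1 ≤ n := by omega
    have a1 := ssum_setx g (i+1) (ent g (i+1) + 1) (by omega) i2
    have a3 := ssum_setx (setx g (i+1) (ent g (i+1) + 1)) i (ent g i - 1) i1 hi
    have a2 := ent_le g i i1 hi
    simp [ent_setx, h1, h6, i1, hi, i2] at a3 ⊢
    omega
  · rw [if_neg h9] at h
    exact absurd h (by simp)

theorem f_some {n l i : ℕ} (hn : 2 ≤ n) (hi : i ≤ n) (b b' : Tup n) (hb : b ∈ BC n l)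
    (h : fC n l i b = some b') : b' ∈ BC n l ∧ FF n l i b = FF n l i b' + 1 := by
  obtain ⟨f, g⟩ := b
  have hb' : tsum (f, g) ≤ l ∧ (l - tsum (f, g)) % 2 = 0 := hb
  change memC n l b' ∧ _
  unfold fC at h
  unfold FF memC
  have hn1 : 1 ≤ n := by omega
  by_cases h1 : i = 0
  · rw [if_pos h1, if_pos (show 0 < n by omega)] at h
    by_cases h3 : xbc (f, g) 1 ≤ xc (f, g) 1
    · rw [if_pos h3] at h
      by_cases h5 : tsum (f, g) + 2 ≤ l
      · rw [if_pos h5] at h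
        obtain rfl := Option.some.inj h; clear h; simp only [tsum_eq, xc_eq, xbc_eq] at *
        subst h1
        have a1 := ssum_setx f 1 (ent f 1 + 2) le_rfl hn1
        simp [ent_setx, hn1]
        omega
      · rw [if_neg h5] at h
        exact absurd h (by simp)
    rw [if_neg h3] at h
    by_cases h4 : xc (f, g) 1 + 1 = xbc (f, g) 1
    · rw [if_pos h4] at h
      obtain rfl := Option.some.inj h; clear h; simp only [tsum_eq, xc_eq, xbc_eq] at *
      subst h1
      have a1 := ssum_setx f 1 (ent f 1 + 1) le_rfl hn1
      have a3 := ssum_setx g 1 (ent g 1 - 1) le_rfl hn1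
      have a2 := ent_le g 1 le_rfl hn1
      simp [ent_setx, hn1]
      omega
    · rw [if_neg h4] at h
      obtain rfl := Option.some.inj h; clear h; simp only [tsum_eq, xc_eq, xbc_eq] at *
      subst h1
      have a3 := ssum_setx g 1 (ent g 1 - 2) le_rfl hn1
      have a2 := ent_le g 1 le_rfl hn1
      simp [ent_setx, hn1]
      omega
  rw [if_neg h1] at h
  by_cases h6 : i = n
  · rw [if_pos h6] at h
    by_cases h7 : 0 < xc (f, g) n
    · rw [if_pos h7] at h
      obtain rfl := Option.some.inj h; clear h; simp only [tsum_eq, xc_eq, xbc_eq] at *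
      subst h6
      have a1 := ssum_setx f i (ent f i - 1) hn1 le_rfl
      have a3 := ssum_setx g i (ent g i + 1) hn1 le_rfl
      have a2 := ent_le f i hn1 le_rfl
      simp [ent_setx, hn1, h1]
      omega
    · rw [if_neg h7] at h
      exact absurd h (by simp)
  rw [if_neg h6, if_pos (show i < n by omega)] at h
  by_cases h8 : xbc (f, g) (i + 1) ≤ xc (f, g) (i + 1)
  · rw [if_pos h8] at h
    by_cases h9 : 0 < xc (f, g) i
    · rw [if_pos h9] at h
      obtain rfl := Option.some.inj h; clear h; simp only [tsum_eq, xc_eq, xbc_eq] at *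
      have i1 : 1 ≤ i := by omega
      have i2 : i + 1 ≤ n := by omega
      have a1 := ssum_setx f i (ent f i - 1) i1 hi
      have a3 := ssum_setx (setx f i (ent f i - 1)) (i+1) (ent f (i+1) + 1) (by omega) i2
      have a2 := ent_le f i i1 hi
      simp [ent_setx, h1, h6, i1, hi, i2] at a3 ⊢
      omega
    · rw [if_neg h9] at h
      exact absurd h (by simp)
  · rw [if_neg h8] at h
    obtain rfl := Option.some.inj h; clear h; simp only [tsum_eq, xc_eq, xbc_eq] at *
    have i1 : 1 ≤ i := by omega
    have i2 : i + 1 ≤ n := by omega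
    have a1 := ssum_setx g (i+1) (ent g (i+1) - 1) (by omega) i2
    have a3 := ssum_setx (setx g (i+1) (ent g (i+1) - 1)) i (ent g i + 1) i1 hi
    have a2 := ent_le g (i+1) (by omega) i2
    simp [ent_setx, h1, h6, i1, hi, i2] at a3 ⊢
    omega

theorem eps_eq {n l i : ℕ} (hn : 2 ≤ n) (hi : i ≤ n) (b : Tup n) (hb : b ∈ BC n l) :
    epsC n l i b = EE n l i b :=
  aux_sup (eC n l i) (· ∈ BC n l) (EE n l i) (fun b _ h => e_none hn hi b h)
    (fun b b' hb h => e_some hn hi b b' hb h) b hb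

theorem phi_eq {n l i : ℕ} (hn : 2 ≤ n) (hi : i ≤ n) (b : Tup n) (hb : b ∈ BC n l) :
    phiC n l i b = FF n l i b :=
  aux_sup (fC n l i) (· ∈ BC n l) (FF n l i) (fun b _ h => f_none hn hi b h)
    (fun b b' hb h => f_some hn hi b b' hb h) b hb

theorem e_none' {n l i : ℕ} (hn : 2 ≤ n) (hi : i ≤ n) (b : Tup n) (hb : b ∈ BC n l)
    (h : EE n l i b = 0) : eC n l i b = none := by
  cases h' : eC n l i b with
  | none => rfl
  | some b' => have := (e_some hn hi b b' hb h').2; omega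

theorem f_none' {n l i : ℕ} (hn : 2 ≤ n) (hi : i ≤ n) (b : Tup n) (hb : b ∈ BC n l)
    (h : FF n l i b = 0) : fC n l i b = none := by
  cases h' : fC n l i b with
  | none => rfl
  | some b' => have := (f_some hn hi b b' hb h').2; omega

theorem eTen_eq {n l k i : ℕ} (hn : 2 ≤ n) (hi : i ≤ n) (b c : Tup n) (hb : b ∈ BC n l)
    (hc : c ∈ BC n k) : eTenC n l k i (b, c) =
      if EE n k i c ≤ FF n l i b then (eC n l i b).map (fun d => (d, c))
      else (eC n k i c).map (fun d => (b, d)) := by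
  simp only [eTenC, eps_eq hn hi c hc, phi_eq hn hi b hb]

theorem fTen_eq {n l k i : ℕ} (hn : 2 ≤ n) (hi : i ≤ n) (b c : Tup n) (hb : b ∈ BC n l)
    (hc : c ∈ BC n k) : fTenC n l k i (b, c) =
      if EE n k i c < FF n l i b then (fC n l i b).map (fun d => (d, c))
      else (fC n k i c).map (fun d => (b, d)) := by
  simp only [fTenC, eps_eq hn hi c hc, phi_eq hn hi b hb]

theorem eTen_none {n l k i : ℕ} (hn : 2 ≤ n) (hi : i ≤ n) (b c : Tup n) (hb : b ∈ BC n l)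
    (hc : c ∈ BC n k) : eTenC n l k i (b, c) = none ↔
      EE n l i b = 0 ∧ EE n k i c ≤ FF n l i b := by
  rw [eTen_eq hn hi b c hb hc]
  split_ifs with h
  · simp only [Option.map_eq_none_iff]
    exact ⟨fun h' => ⟨e_none hn hi b h', h⟩, fun h' => e_none' hn hi b hb h'.1⟩
  · simp only [Option.map_eq_none_iff]
    refine ⟨fun h' => ?_, fun h' => absurd h'.2 h⟩
    have := e_none hn hi c h'
    omega

theorem fTen_none {n l k i : ℕ} (hn : 2 ≤ n) (hi : i ≤ n) (b c : Tup n) (hb : b ∈ BC n l)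
    (hc : c ∈ BC n k) : fTenC n l k i (b, c) = none ↔
      FF n k i c = 0 ∧ FF n l i b ≤ EE n k i c := by
  rw [fTen_eq hn hi b c hb hc]
  split_ifs with h
  · simp only [Option.map_eq_none_iff]
    refine ⟨fun h' => ?_, fun h' => by omega⟩
    have := f_none hn hi b h'
    omega
  · simp only [Option.map_eq_none_iff]
    exact ⟨fun h' => ⟨f_none hn hi c h', by omega⟩, fun h' => f_none' hn hi c hc h'.1⟩

theorem fTen_some {n l k i : ℕ} (hn : 2 ≤ n) (hi : i ≤ n) (u v : Tup n × Tup n)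
    (hu : u ∈ BC n l ×ˢ BC n k) (h : fTenC n l k i u = some v) :
    FF n l i u.1 + FF n k i u.2 = FF n l i v.1 + FF n k i v.2 + 1 := by
  obtain ⟨b, c⟩ := u
  rw [fTen_eq hn hi b c hu.1 hu.2] at h
  split_ifs at h
  · obtain ⟨d, hd, rfl⟩ := Option.map_eq_some_iff.mp h
    have := (f_some hn hi b d hu.1 hd).2
    simp only; omega
  · obtain ⟨d, hd, rfl⟩ := Option.map_eq_some_iff.mp h
    have := (f_some hn hi c d hu.2 hd).2
    simp only; omega

theorem phi_bound {n l k i : ℕ} (hn : 2 ≤ n) (hi : i ≤ n)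
    (ι : Tup n × Tup n → Tup n × Tup n) (hι : IsIsoC n l k ι) (b : Tup n) (hb : b ∈ BC n l)
    (h0 : FF n l i b = 0) : ∀ m, ∀ c ∈ BC n k, FF n k i c = m →
      m ≤ FF n k i (ι (b, c)).1 + FF n l i (ι (b, c)).2 := by
  intro m
  induction m with
  | zero => intros; omega
  | succ m ih =>
    intro c hc hm
    cases hf : fC n k i c with
    | none => have := f_none hn hi c hf; omega
    | some d =>
      obtain ⟨hd, hd2⟩ := f_some hn hi c d hc hf
      have h1 := ih d hd (by omega)
      have h2 := (hι.2 (b, c) ⟨hb, hc⟩ i hi).2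
      rw [fTen_eq hn hi b c hb hc, h0, if_neg (by omega), hf] at h2
      simp only [Option.map_some] at h2
      have h3 := fTen_some hn hi (ι (b, c)) _ (hι.1.mapsTo ⟨hb, hc⟩) h2.symm
      omega

/-! triple vectors -/

theorem T1_eq (n a c d : ℕ) :
    (tripleVec n a c d).1 = setx (setx (fun _ => 0) 1 a) 2 c := by
  funext t
  simp only [tripleVec, setx]
  split_ifs <;> first | rfl | omega

theorem T2_eq (n a c d : ℕ) : (tripleVec n a c d).2 = setx (fun _ => 0) 1 d := by
  funext t
  simp only [tripleVec, setx]
  split_ifs <;> first | rfl | omega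

theorem xc_T {n : ℕ} (a c d j : ℕ) (h1 : 1 ≤ j) (h2 : j ≤ n) :
    xc (tripleVec n a c d) j = if j = 1 then a else if j = 2 then c else 0 := by
  rw [xc_eq, T1_eq, ent_setx _ _ _ _ h1 h2, ent_setx _ _ _ _ h1 h2]
  simp only [ent]
  split_ifs <;> first | rfl | omega

theorem xbc_T {n : ℕ} (a c d j : ℕ) (h1 : 1 ≤ j) (h2 : j ≤ n) :
    xbc (tripleVec n a c d) j = if j = 1 then d else 0 := by
  rw [xbc_eq, T2_eq, ent_setx _ _ _ _ h1 h2]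
  simp only [ent]
  split_ifs <;> first | rfl | omega

theorem tsum_T {n : ℕ} (hn : 2 ≤ n) (a c d : ℕ) : tsum (tripleVec n a c d) = a + c + d := by
  rw [tsum_eq, T1_eq, T2_eq]
  have h1 := ssum_setx (n := n) (fun _ => 0) 1 a le_rfl (by omega)
  have h2 := ssum_setx (n := n) (setx (fun _ => 0) 1 a) 2 c (by omega) hn
  have h3 := ssum_setx (n := n) (fun _ => 0) 1 d le_rfl (by omega)
  rw [ent_setx _ _ _ _ (by omega) hn] at h2
  simp [ent] at h1 h2 h3
  have h4 : wsum (fun _ => 1) (fun _ : Fin n => 0) = 0 := by simp [wsum]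
  omega

theorem T_mem {n l : ℕ} (hn : 2 ≤ n) (a c d : ℕ) (h : a + c + d ≤ l)
    (h' : (l - (a + c + d)) % 2 = 0) : tripleVec n a c d ∈ BC n l := by
  change memC _ _ _
  rw [memC, tsum_T hn]; exact ⟨h, h'⟩

theorem uvec_T (n v : ℕ) : uvec n v = tripleVec n v 0 0 := by
  simp [uvec, tripleVec]

theorem u2vec_T (n v : ℕ) : u2vec n v = tripleVec n 0 v 0 := by
  simp only [u2vec, tripleVec, Prod.mk.injEq]
  constructor <;> funext t <;> split_ifs <;> first | rfl | omega

theorem EE0_T {n l : ℕ} (hn : 2 ≤ n) (a c d : ℕ) :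
    EE n l 0 (tripleVec n a c d) = (l - (a + c + d)) / 2 + (a - d) := by
  simp [EE, tsum_T hn, xc_T, xbc_T, show 1 ≤ n by omega]

theorem FF0_T {n l : ℕ} (hn : 2 ≤ n) (a c d : ℕ) :
    FF n l 0 (tripleVec n a c d) = (l - (a + c + d)) / 2 + (d - a) := by
  simp [FF, tsum_T hn, xc_T, xbc_T, show 1 ≤ n by omega]

theorem EE1_T {n l : ℕ} (hn : 2 ≤ n) (a c d : ℕ) :
    EE n l 1 (tripleVec n a c d) = d + c := by
  simp [EE, xc_T, xbc_T, show 1 ≤ n by omega, hn, show (1:ℕ) ≠ n by omega]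

theorem FF1_T {n l : ℕ} (hn : 2 ≤ n) (a c d : ℕ) :
    FF n l 1 (tripleVec n a c d) = a := by
  simp [FF, xc_T, xbc_T, show 1 ≤ n by omega, hn, show (1:ℕ) ≠ n by omega]

theorem EE2_T {n l i : ℕ} (hn : 2 ≤ n) (a c d : ℕ) (h1 : 2 ≤ i) (h2 : i ≤ n) :
    EE n l i (tripleVec n a c d) = 0 := by
  unfold EE
  split_ifs with h3 h4
  · omega
  · rw [xbc_T _ _ _ _ (by omega) (by omega), if_neg (by omega)]
  · rw [xbc_T _ _ _ _ (by omega) (by omega), xbc_T _ _ _ _ (by omega) (by omega),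
      xc_T _ _ _ _ (by omega) (by omega), if_neg (by omega), if_neg (by omega),
      if_neg (by omega)]
    simp

theorem FF2_T {n l i : ℕ} (hn : 2 ≤ n) (a c d : ℕ) (h1 : 2 ≤ i) (h2 : i ≤ n) :
    FF n l i (tripleVec n a c d) = if i = 2 then c else 0 := by
  unfold FF
  split_ifs with h3 h4 h5 h6 h7
  all_goals try omega
  all_goals simp (discharger := omega) only [xc_T, xbc_T]
  all_goals split_ifs <;> omega

theorem T_ext {n : ℕ} (hn : 2 ≤ n) (b : Tup n) (h1 : ∀ j, 2 ≤ j → j ≤ n → xbc b j = 0)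
    (h2 : ∀ j, 3 ≤ j → j ≤ n → xc b j = 0) :
    b = tripleVec n (xc b 1) (xc b 2) (xbc b 1) := by
  have hx : ∀ t : Fin n, b.1 t = xc b (t + 1) := by intro t; simp [xc]
  have hy : ∀ t : Fin n, b.2 t = xbc b (t + 1) := by intro t; simp [xbc]
  apply Prod.ext <;> funext t
  · simp only [tripleVec]
    rw [hx]
    split_ifs with h3 h4
    · rw [h3]
    · rw [h4]
    · exact h2 _ (by omega) (by omega)
  · simp only [tripleVec]
    rw [hy]
    split_ifs with h3
    · rw [h3]
    · exact h1 _ (by omega) (by omega)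

theorem T_of_EE {n l : ℕ} (hn : 2 ≤ n) (b : Tup n)
    (h : ∀ i, 2 ≤ i → i ≤ n → EE n l i b = 0) :
    b = tripleVec n (xc b 1) (xc b 2) (xbc b 1) := by
  have hb : ∀ j, 2 ≤ j → j ≤ n → xbc b j = 0 := by
    intro j hj1 hj2
    have := h j hj1 hj2
    unfold EE at this
    split_ifs at this with h3 h4
    · omega
    · rw [h4]; exact this
    · omega
  apply T_ext hn b hb
  intro j hj1 hj2
  have := h (j - 1) (by omega) (by omega)
  unfold EE at this
  rw [if_neg (by omega), if_neg (by omega), show j - 1 + 1 = j by omega] at this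
  have := hb j (by omega) hj2
  omega

theorem T_of_EE1 {n l : ℕ} (hn : 2 ≤ n) (b : Tup n)
    (h : ∀ i, 1 ≤ i → i ≤ n → EE n l i b = 0) :
    b = tripleVec n (xc b 1) 0 0 := by
  have h1 := T_of_EE (l := l) hn b (fun i hi => h i (by omega))
  have h2 := h 1 le_rfl (by omega)
  rw [h1, EE1_T hn] at h2
  have h3 : xc b 2 = 0 := by omega
  have h4 : xbc b 1 = 0 := by omega
  rw [h3, h4] at h1
  exact h1

/-! explicit actions -/

theorem e0_T {n L : ℕ} (hn : 2 ≤ n) (s c j : ℕ) (hs : s + c = L) (hj : j < s) :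
    eC n L 0 (tripleVec n (s - 2 * j) c (2 * j - s)) =
      some (tripleVec n (s - 2 * (j + 1)) c (2 * (j + 1) - s)) := by
  unfold eC
  rw [xc_T _ _ _ _ le_rfl (by omega), xbc_T _ _ _ _ le_rfl (by omega), tsum_T hn]
  simp only [if_true, if_pos (show 0 < n by omega)]
  split_ifs with h1 h2 h3
  · congr 1
    apply Prod.ext <;> funext t <;> simp only [setx, tripleVec] <;> split_ifs <;> omega
  · congr 1
    apply Prod.ext <;> funext t <;> simp only [setx, tripleVec] <;> split_ifs <;> omega
  · congr 1
    apply Prod.ext <;> funext t <;> simp only [setx, tripleVec] <;> split_ifs <;> omega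
  · omega

theorem EE0_chain {n L : ℕ} (hn : 2 ≤ n) (s c j : ℕ) (hs : s + c = L) (hj : j ≤ s) :
    EE n L 0 (tripleVec n (s - 2 * j) c (2 * j - s)) = s - j := by
  rw [EE0_T hn]; omega

theorem FF0_chain {n L : ℕ} (hn : 2 ≤ n) (s c j : ℕ) (hs : s + c = L) (hj : j ≤ s) :
    FF n L 0 (tripleVec n (s - 2 * j) c (2 * j - s)) = j := by
  rw [FF0_T hn]; omega

theorem e1_T {n L : ℕ} (hn : 2 ≤ n) (a c d : ℕ) :
    eC n L 1 (tripleVec n a (c + 1) d) = some (tripleVec n (a + 1) c d) := by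
  unfold eC
  simp (discharger := omega) only [xc_T, xbc_T, tsum_T]
  rw [if_neg (by omega), if_neg (by omega), if_pos (by omega), if_pos (by norm_num)]
  congr 1
  apply Prod.ext <;> funext t <;> simp only [setx, tripleVec] <;> split_ifs <;> omega

theorem f1_T {n L : ℕ} (hn : 2 ≤ n) (a c d : ℕ) :
    fC n L 1 (tripleVec n (a + 1) c d) = some (tripleVec n a (c + 1) d) := by
  unfold fC
  simp (discharger := omega) only [xc_T, xbc_T, tsum_T]
  rw [if_neg (by omega), if_neg (by omega), if_pos (by omega), if_pos (by norm_num),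
    if_pos (by norm_num)]
  congr 1
  apply Prod.ext <;> funext t <;> simp only [setx, tripleVec] <;> split_ifs <;> omega

/-! the measure -/

/-- height of an element -/
def hgt {n : ℕ} (b : Tup n) : ℕ :=
  wsum (fun t => t + 1) b.1 + wsum (fun t => 2 * n - t) b.2

theorem wsum_inc {n : ℕ} (w : ℕ → ℕ) (f : Fin n → ℕ) (j v : ℕ) (h1 : 1 ≤ j) (h2 : j ≤ n)
    (hv : v = ent f j + 1) :
    wsum w (setx f j v) = wsum w f + w (j - 1) := by
  have := wsum_setx w f j v h1 h2
  subst hv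
  rw [mul_add] at this
  omega

theorem wsum_dec {n : ℕ} (w : ℕ → ℕ) (f : Fin n → ℕ) (j v : ℕ) (h1 : 1 ≤ j) (h2 : j ≤ n)
    (hv : v + 1 = ent f j) :
    wsum w (setx f j v) + w (j - 1) = wsum w f := by
  have := wsum_setx w f j v h1 h2
  rw [← hv, mul_add] at this
  omega

theorem e_hgt {n l i : ℕ} (hn : 2 ≤ n) (hi : i ≤ n) (hi1 : 1 ≤ i) (b b' : Tup n)
    (h : eC n l i b = some b') : tsum b' = tsum b ∧ hgt b = hgt b' + 1 := by
  obtain ⟨f, g⟩ := b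
  unfold eC at h
  unfold hgt
  have hn1 : 1 ≤ n := by omega
  rw [if_neg (by omega)] at h
  by_cases h6 : i = n
  · rw [if_pos h6] at h
    by_cases h7 : 0 < xbc (f, g) n
    · rw [if_pos h7] at h
      obtain rfl := Option.some.inj h; clear h; simp only [tsum_eq, xc_eq, xbc_eq] at *
      subst h6
      have a1 := fun w => wsum_inc w f i (ent f i + 1) hn1 le_rfl rfl
      have a3 := fun w => wsum_dec w g i (ent g i - 1) hn1 le_rfl (by omega)
      have b1 := a1 (fun _ => 1)
      have b2 := a1 (fun t => t + 1)
      have b3 := a3 (fun _ => 1)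
      have b4 := a3 (fun t => 2 * i - t)
      omega
    · rw [if_neg h7] at h
      exact absurd h (by simp)
  rw [if_neg h6, if_pos (show i < n by omega)] at h
  by_cases h8 : xbc (f, g) (i + 1) < xc (f, g) (i + 1)
  · rw [if_pos h8] at h
    obtain rfl := Option.some.inj h; clear h; simp only [tsum_eq, xc_eq, xbc_eq] at *
    have i2 : i + 1 ≤ n := by omega
    have a1 := fun w => wsum_inc w f i (ent f i + 1) hi1 hi rfl
    have a3 := fun w => wsum_dec w (setx f i (ent f i + 1)) (i+1) (ent f (i+1) - 1) (by omega) i2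
      (by rw [ent_setx _ _ _ _ (by omega) i2, if_neg (by omega)]; omega)
    have b1 := a1 (fun _ => 1)
    have b2 := a1 (fun t => t + 1)
    have b3 := a3 (fun _ => 1)
    have b4 := a3 (fun t => t + 1)
    omega
  rw [if_neg h8] at h
  by_cases h9 : 0 < xbc (f, g) i
  · rw [if_pos h9] at h
    obtain rfl := Option.some.inj h; clear h; simp only [tsum_eq, xc_eq, xbc_eq] at *
    have i2 : i + 1 ≤ n := by omega
    have a1 := fun w => wsum_inc w g (i+1) (ent g (i+1) + 1) (by omega) i2 rfl
    have a3 := fun w => wsum_dec w (setx g (i+1) (ent g (i+1) + 1)) i (ent g i - 1) hi1 hi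
      (by rw [ent_setx _ _ _ _ (by omega) hi, if_neg (by omega)]; omega)
    have b1 := a1 (fun _ => 1)
    have b2 := a1 (fun t => 2 * n - t)
    have b3 := a3 (fun _ => 1)
    have b4 := a3 (fun t => 2 * n - t)
    omega
  · rw [if_neg h9] at h
    exact absurd h (by simp)

/-! consequences for the isomorphism and the energy function -/

theorem iota_hw {n l k : ℕ} (hn : 2 ≤ n)
    (ι : Tup n × Tup n → Tup n × Tup n) (hι : IsIsoC n l k ι) (m : ℕ) (hm : m = min l k) :
    ι (tripleVec n l 0 0, tripleVec n (k - m) m 0) =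
      (tripleVec n k 0 0, tripleVec n (l - m) m 0) := by
  have hb : tripleVec n l 0 0 ∈ BC n l := T_mem hn _ _ _ (by omega) (by omega)
  have hc : tripleVec n (k - m) m 0 ∈ BC n k := T_mem hn _ _ _ (by omega) (by omega)
  have hmem := hι.1.mapsTo (Set.mk_mem_prod hb hc)
  have hcomm := hι.2 _ (Set.mk_mem_prod hb hc)
  have hbound := phi_bound hn hn ι hι _ hb (by rw [FF2_T hn _ _ _ le_rfl hn]; rfl) m _ hc
    (by rw [FF2_T hn _ _ _ le_rfl hn]; rfl)
  generalize ι (tripleVec n l 0 0, tripleVec n (k - m) m 0) = x at *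
  obtain ⟨b, c⟩ := x
  obtain ⟨hb', hc'⟩ := hmem
  simp only at hb' hc' hbound
  have he : ∀ i, 1 ≤ i → i ≤ n → EE n k i b = 0 ∧ EE n l i c ≤ FF n k i b := by
    intro i h1 h2
    rw [← eTen_none hn h2 b c hb' hc', ← (hcomm i h2).1, Option.map_eq_none_iff,
      eTen_none hn h2 _ _ hb hc]
    rcases Nat.lt_or_ge 1 i with h3 | h3
    · rw [EE2_T hn _ _ _ h3 h2, EE2_T hn _ _ _ h3 h2]; simp
    · obtain rfl : i = 1 := by omega
      rw [EE1_T hn, EE1_T hn, FF1_T hn]; omega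
  have hf : FF n l 0 c = 0 ∧ FF n k 0 b ≤ EE n l 0 c := by
    rw [← fTen_none hn (by omega) b c hb' hc', ← (hcomm 0 (by omega)).2, Option.map_eq_none_iff,
      fTen_none hn (by omega) _ _ hb hc, FF0_T hn, FF0_T hn, EE0_T hn]
    omega
  have hbT := T_of_EE1 hn b (fun i h1 h2 => (he i h1 h2).1)
  generalize xc b 1 = a at hbT
  subst hbT
  have hcT := T_of_EE (l := l) hn c (fun i h1 h2 => by
    have := (he i (by omega) h2).2
    rw [FF2_T hn _ _ _ h1 h2] at this
    simpa using this)
  generalize xc c 1 = p at hcT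
  generalize xc c 2 = q at hcT
  generalize xbc c 1 = r at hcT
  subst hcT
  have h1 := (he 1 le_rfl (by omega)).2
  rw [EE1_T hn, FF1_T hn] at h1
  rw [FF0_T hn, FF0_T hn, EE0_T hn] at hf
  rw [FF2_T hn _ _ _ le_rfl hn, FF2_T hn _ _ _ le_rfl hn] at hbound
  simp only [if_true] at hbound
  change memC _ _ _ at hb' hc'
  rw [memC, tsum_T hn] at hb' hc'
  obtain ⟨rfl, rfl, rfl, rfl⟩ : a = k ∧ p = l - m ∧ q = m ∧ r = 0 := by omega
  rfl

theorem iota_start {n l k : ℕ} (hn : 2 ≤ n)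
    (ι : Tup n × Tup n → Tup n × Tup n) (hι : IsIsoC n l k ι) (m : ℕ) (hm : m = min l k) :
    ∀ j, j ≤ k - m → ι (tripleVec n l 0 0, tripleVec n (k - m - j) (m + j) 0) =
      (tripleVec n (k - j) j 0, tripleVec n (l - m) m 0) := by
  intro j
  induction j with
  | zero => intro _; simpa using iota_hw hn ι hι m hm
  | succ j ih =>
    intro hj
    have ih := ih (by omega)
    have hb : tripleVec n l 0 0 ∈ BC n l := T_mem hn _ _ _ (by omega) (by omega)
    have hc : tripleVec n (k - m - j) (m + j) 0 ∈ BC n k := T_mem hn _ _ _ (by omega) (by omega)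
    have hcomm := (hι.2 _ (Set.mk_mem_prod hb hc) 1 (by omega)).2
    rw [ih, fTen_eq hn (by omega) _ _ hb hc,
      fTen_eq hn (by omega) _ _ (T_mem hn _ _ _ (by omega) (by omega))
        (T_mem hn _ _ _ (by omega) (by omega)), EE1_T hn, FF1_T hn, EE1_T hn, FF1_T hn,
      if_neg (by omega), if_pos (by omega),
      show k - m - j = k - m - (j + 1) + 1 by omega,
      show k - j = k - (j + 1) + 1 by omega, f1_T hn, f1_T hn] at hcomm
    simp only [Option.map_some, Option.some.injEq] at hcomm
    exact hcomm

set_option maxHeartbeats 1000000 in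
theorem e0_path {n l k : ℕ} (hn : 2 ≤ n)
    (ι : Tup n × Tup n → Tup n × Tup n) (hι : IsIsoC n l k ι) (H : Tup n × Tup n → ℤ)
    (hH : IsEnergyC n l k ι H) (m : ℕ) (hm : m = min l k) :
    ∀ j, j ≤ l → ι (tripleVec n (l - 2 * j) 0 (2 * j - l), tripleVec n 0 k 0) =
      (tripleVec n (m - 2 * (j - (l - m))) (k - m) (2 * (j - (l - m)) - m),
        tripleVec n ((l - m) - 2 * (min j (l - m))) m (2 * (min j (l - m)) - (l - m))) ∧
      H (tripleVec n (l - 2 * j) 0 (2 * j - l), tripleVec n 0 k 0) = ((j - (l - m) : ℕ) : ℤ) := by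
  intro j
  induction j with
  | zero =>
    intro _
    have h1 := iota_start hn ι hι m hm (k - m) le_rfl
    have h2 := hH.2
    rw [uvec_T, u2vec_T] at h2
    rw [show k - m - (k - m) = 0 by omega, show m + (k - m) = k by omega,
      show k - (k - m) = m by omega] at h1
    simp [h1, h2]
  | succ j ih =>
    intro hj
    obtain ⟨ih1, ih2⟩ := ih (by omega)
    have hb : tripleVec n (l - 2 * j) 0 (2 * j - l) ∈ BC n l :=
      T_mem hn _ _ _ (by omega) (by omega)
    have hc : tripleVec n 0 k 0 ∈ BC n k := T_mem hn _ _ _ (by omega) (by omega)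
    have hcomm := (hι.2 _ (Set.mk_mem_prod hb hc) 0 (by omega)).1
    have hmem := hι.1.mapsTo (Set.mk_mem_prod hb hc)
    have hten : eTenC n l k 0 (tripleVec n (l - 2 * j) 0 (2 * j - l), tripleVec n 0 k 0) =
        some (tripleVec n (l - 2 * (j + 1)) 0 (2 * (j + 1) - l), tripleVec n 0 k 0) := by
      rw [eTen_eq hn (by omega) _ _ hb hc, EE0_T hn, FF0_T hn, if_pos (by omega),
        e0_T hn l 0 j (by omega) (by omega)]
      rfl
    have hen := hH.1 _ (Set.mk_mem_prod hb hc) 0 (by omega) _ hten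
    rw [ih1] at hmem
    rw [hten, ih1] at hcomm
    rw [ih1, ih2] at hen
    rw [eTen_eq hn (by omega) _ _ hmem.1 hmem.2] at hcomm
    simp only [Option.map_some] at hcomm
    have hml : m ≤ l := by omega
    have hmk : m ≤ k := by omega
    have q1 : EE n k 0 (tripleVec n 0 k 0) = 0 := by rw [EE0_T hn]; omega
    have q2 := EE0_chain (L := l) hn (l - m) m (min j (l - m)) (by omega) (by omega)
    have q3 := FF0_chain (L := k) hn m (k - m) (j - (l - m)) (by omega) (by omega)
    simp only [if_true] at hen
    rw [eps_eq hn (Nat.zero_le n) _ hmem.2, phi_eq hn (Nat.zero_le n) _ hmem.1,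
      eps_eq hn (Nat.zero_le n) _ hc] at hen
    simp only at hen
    rw [q1, q2, q3] at hen
    rw [q2, q3] at hcomm
    clear q1 q2 q3 hm ih1 ih2 hten hmem hb hc
    rcases Nat.lt_or_ge j (l - m) with hlt | hge
    · rw [if_neg (by omega), min_eq_left hlt.le, e0_T hn (l - m) m j (by omega) hlt] at hcomm
      rw [if_neg (by omega), if_neg (by omega)] at hen
      simp only [Option.map_some, Option.some.injEq] at hcomm
      rw [hcomm, hen, min_eq_left (by omega : j + 1 ≤ l - m),
        show j + 1 - (l - m) = 0 by omega, show j - (l - m) = 0 by omega]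
      simp
    · rw [if_pos (by omega), min_eq_right hge,
        e0_T hn m (k - m) (j - (l - m)) (by omega) (by omega)] at hcomm
      rw [if_pos (by omega)] at hen
      simp only [Option.map_some, Option.some.injEq] at hcomm
      rw [hcomm, hen, min_eq_right (by omega : l - m ≤ j + 1),
        show j + 1 - (l - m) = j - (l - m) + 1 by omega]
      simp

theorem e1_path {n l k : ℕ} (hn : 2 ≤ n)
    (ι : Tup n × Tup n → Tup n × Tup n) (H : Tup n × Tup n → ℤ)
    (hH : IsEnergyC n l k ι H) :
    ∀ j, j ≤ k → H (tripleVec n 0 0 l, tripleVec n j (k - j) 0) =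
      H (tripleVec n 0 0 l, tripleVec n 0 k 0) := by
  intro j
  induction j with
  | zero => intro _; simp
  | succ j ih =>
    intro hj
    have hb : tripleVec n 0 0 l ∈ BC n l := T_mem hn _ _ _ (by omega) (by omega)
    have hc : tripleVec n j (k - j) 0 ∈ BC n k := T_mem hn _ _ _ (by omega) (by omega)
    rw [← ih (by omega)]
    have := hH.1 _ (Set.mk_mem_prod hb hc) 1 (by omega)
      (tripleVec n 0 0 l, tripleVec n (j + 1) (k - (j + 1)) 0) (by
        rw [eTen_eq hn (by omega) _ _ hb hc, EE1_T hn, FF1_T hn, if_neg (by omega),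
          show k - j = k - (j + 1) + 1 by omega, e1_T hn]
        rfl)
    simpa using this

theorem lift_path {n l k : ℕ} (hn : 2 ≤ n)
    (ι : Tup n × Tup n → Tup n × Tup n) (H : Tup n × Tup n → ℤ)
    (hH : IsEnergyC n l k ι H) :
    ∀ N, ∀ b : Tup n, hgt b = N → tsum b = l →
      H (b, tripleVec n k 0 0) = H (tripleVec n l 0 0, tripleVec n k 0 0) := by
  intro N
  induction N with
  | zero =>
    intro b hN hb
    have hbm : b ∈ BC n l := ⟨hb.le, by omega⟩
    have := T_of_EE1 (l := l) hn b (fun i h1 h2 => by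
      cases h : eC n l i b with
      | none => exact e_none hn h2 b h
      | some b' => have := (e_hgt hn h2 h1 b b' h).2; omega)
    rw [this, tsum_T hn] at hb
    rw [this, show xc b 1 = l by omega]
  | succ N ih =>
    intro b hN hb
    have hbm : b ∈ BC n l := ⟨hb.le, by omega⟩
    have hc : tripleVec n k 0 0 ∈ BC n k := T_mem hn _ _ _ (by omega) (by omega)
    by_cases hex : ∃ i b', 1 ≤ i ∧ i ≤ n ∧ eC n l i b = some b'
    · obtain ⟨i, b', h1, h2, h⟩ := hex
      obtain ⟨h3, h4⟩ := e_hgt hn h2 h1 b b' h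
      rw [← ih b' (by omega) (by omega)]
      have h0 : EE n k i (tripleVec n k 0 0) = 0 := by
        rcases Nat.lt_or_ge 1 i with h3 | h3
        · exact EE2_T hn _ _ _ h3 h2
        · obtain rfl : i = 1 := by omega
          rw [EE1_T hn]
      have := hH.1 _ (Set.mk_mem_prod hbm hc) i h2 (b', tripleVec n k 0 0) (by
        rw [eTen_eq hn h2 _ _ hbm hc, h0, if_pos (by omega), h]; rfl)
      rw [if_neg (by omega)] at this
      omega
    · have := T_of_EE1 (l := l) hn b (fun i h1 h2 => by
        cases h : eC n l i b with
        | none => exact e_none hn h2 b h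
        | some b' => exact absurd ⟨i, b', h1, h2, h⟩ hex)
      rw [this, tsum_T hn] at hb
      rw [this, show xc b 1 = l by omega]

/-- **Corollary 4.4.**  `H((l,0,…,0) ⊗ (k,0,…,0)) = min(l,k)`. -/
theorem corollary_4_4
    (n l k : ℕ) (hn : 2 ≤ n) (hl : 1 ≤ l) (hk : 1 ≤ k)
    (ι : Tup n × Tup n → Tup n × Tup n) (hι : IsIsoC n l k ι)
    (H : Tup n × Tup n → ℤ) (hH : IsEnergyC n l k ι H) :
    H (uvec n l, uvec n k) = ((min l k : ℕ) : ℤ) := by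
  have h1 := (e0_path hn ι hι H hH (min l k) rfl l le_rfl).2
  have h2 := e1_path hn ι H hH k le_rfl
  have h3 := lift_path hn ι H hH _ (tripleVec n 0 0 l) rfl (by rw [tsum_T hn]; omega)
  rw [uvec_T, uvec_T, ← h3]
  rw [show l - 2 * l = 0 by omega, show 2 * l - l = l by omega,
    show l - (l - min l k) = min l k by omega] at h1
  rw [Nat.sub_self] at h2
  rw [h2, h1]
end KTT
end
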